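/- arXiv:1009.2059 — 5 statements merged into one kernel-verified Lean document; each statement's English description precedes it below -/
import Mathlib

section
/- For every natural number n ≥ 2, there exists a bijection Θ from the set of functions f : {2, 3, ..., n-1} → {1, ..., n} to the set of trees on the vertex set {1, ..., n} such that for every such function f and every vertex i ∈ {1, ..., n}, the degree of i in the tree Θ(f) equals 1 + |f⁻¹({i})| (the number of preimages of i under f). -/
/-- The set of "interior" vertices of `Fin n`, corresponding to the labels
`{2, ..., n-1}` when vertex `j : Fin n` carries the label `j + 1`. -/
def InteriorDom (n : ℕ) := {j : Fin n // (j : ℕ) ≠ 0 ∧ (j : ℕ) ≠ n - 1}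

/-- Trees on the vertex set `{1, ..., n}` (vertices modeled as `Fin n`):
connected acyclic simple graphs. -/
def TreeOn (n : ℕ) := {G : SimpleGraph (Fin n) // G.Connected ∧ G.IsAcyclic}

namespace SimpleGraph

variable {V : Type} {G : SimpleGraph V} {v : V}

/-- A graph is acyclic if it becomes so after deleting a vertex with at most one neighbor. -/
lemma IsAcyclic.of_induce_compl_singleton (hv : (G.neighborSet v).Subsingleton)
    (h : (G.induce {v}ᶜ).IsAcyclic) : G.IsAcyclic := by
  intro x c hc
  have hvc : v ∉ c.support := by
    by_cases hvx : v = x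
    · subst hvx
      exact absurd (hv (c.adj_snd hc.not_nil) (c.adj_penultimate hc.not_nil).symm)
        hc.snd_ne_penultimate
    · exact hc.isTrail.not_mem_support_of_subsingleton_neighborSet hvx hvx hv
  have hs : ∀ w ∈ c.support, w ∈ ({v}ᶜ : Set V) := by
    rintro w hw rfl
    exact hvc hw
  refine h (c.induce {v}ᶜ hs) (Walk.IsCycle.of_map (f := (Embedding.induce _).toHom) ?_)
  rwa [Walk.map_induce]

/-- A graph is connected if deleting a non-isolated vertex leaves it connected. -/
lemma Connected.of_induce_compl_singleton {u : V} (hu : G.Adj v u)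
    (h : (G.induce {v}ᶜ).Connected) : G.Connected := by
  have key : ∀ w, G.Reachable w u := by
    intro w
    by_cases hw : w = v
    · exact hw ▸ hu.reachable
    · exact (h.preconnected ⟨w, hw⟩ ⟨u, hu.ne'⟩).map (Embedding.induce _).toHom
  have : Nonempty V := ⟨v⟩
  exact ⟨fun a b ↦ (key a).trans (key b).symm⟩

/-- Deleting a leaf lowers the degree of its neighbor by one and preserves all other degrees. -/
lemma card_neighborSet_eq_induce_compl_singleton [Finite V] [DecidableEq V]
    {u : ({v}ᶜ : Set V)} (hv : G.neighborSet v = {u.1}) (w : ({v}ᶜ : Set V)) :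
    Nat.card (G.neighborSet w) =
      Nat.card ((G.induce {v}ᶜ).neighborSet w) + if u = w then 1 else 0 := by
  have himage : Nat.card ((G.induce {v}ᶜ).neighborSet w) = (G.neighborSet w \ {v}).ncard := by
    rw [← Nat.card_image_of_injective Subtype.val_injective]
    refine congrArg Set.ncard ?_
    ext x
    simp [and_comm]
  have hadj : v ∈ G.neighborSet w ↔ u = w := by
    rw [mem_neighborSet, adj_comm, ← mem_neighborSet, hv, Set.mem_singleton_iff, eq_comm,
      Subtype.ext_iff]
  rw [himage]
  split_ifs with h
  · exact (Set.ncard_sdiff_singleton_add_one (hadj.2 h)).symm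
  · rw [Set.sdiff_singleton_eq_self (mt hadj.1 h)]
    rfl

/-- The graph obtained from a graph on the vertices other than `v` by attaching `v` to `u`. -/
def attachLeaf (v : V) (u : ({v}ᶜ : Set V)) (T : SimpleGraph ({v}ᶜ : Set V)) : SimpleGraph V :=
  T.map (Function.Embedding.subtype _) ⊔ edge v u

variable {u : ({v}ᶜ : Set V)} {T : SimpleGraph ({v}ᶜ : Set V)}

lemma neighborSet_attachLeaf : (attachLeaf v u T).neighborSet v = {u.1} := by
  have hu : u.1 ≠ v := u.2
  ext x
  simp only [attachLeaf, mem_neighborSet, sup_adj, map_adj, edge_adj, Set.mem_singleton_iff]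
  constructor
  · rintro (⟨a, b, -, ha, -⟩ | h)
    · exact absurd ha a.2
    · grind
  · grind

lemma induce_attachLeaf : (attachLeaf v u T).induce {v}ᶜ = T := by
  ext a b
  have ha : a.1 ≠ v := a.2
  have hb : b.1 ≠ v := b.2
  simp only [attachLeaf, comap_adj, sup_adj, map_adj, edge_adj]
  simp [ha, hb]

lemma attachLeaf_induce (hv : G.neighborSet v = {u.1}) :
    attachLeaf v u (G.induce {v}ᶜ) = G := by
  ext a b
  by_cases ha : a = v
  · subst ha
    rw [← mem_neighborSet, neighborSet_attachLeaf, ← hv, mem_neighborSet]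
  by_cases hb : b = v
  · subst hb
    rw [adj_comm, ← mem_neighborSet, neighborSet_attachLeaf, ← hv, mem_neighborSet, adj_comm]
  · simp only [attachLeaf, comap_adj, sup_adj, map_adj, edge_adj]
    simp [ha, hb]

end SimpleGraph

open SimpleGraph

/-- Trees with vertex set `V`. -/
abbrev LabelledTree (V : Type) := {G : SimpleGraph V // G.Connected ∧ G.IsAcyclic}

/-- The tree obtained by attaching a leaf `v` to the vertex `p.1` of the tree `p.2`. -/
def LabelledTree.attachLeaf {V : Type} (v : V)
    (p : ({v}ᶜ : Set V) × LabelledTree ({v}ᶜ : Set V)) : LabelledTree V :=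
  ⟨SimpleGraph.attachLeaf v p.1 p.2.1,
    .of_induce_compl_singleton (v := v) (u := p.1)
      (by rw [← mem_neighborSet, neighborSet_attachLeaf, Set.mem_singleton_iff])
      (by rw [induce_attachLeaf]; exact p.2.2.1),
    .of_induce_compl_singleton (v := v)
      (by rw [neighborSet_attachLeaf]; exact Set.subsingleton_singleton)
      (by rw [induce_attachLeaf]; exact p.2.2.2)⟩

lemma LabelledTree.attachLeaf_injective {V : Type} (v : V) :
    Function.Injective (LabelledTree.attachLeaf v) := by
  rintro ⟨u, T⟩ ⟨u', T'⟩ h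
  have h' : SimpleGraph.attachLeaf v u T.1 = SimpleGraph.attachLeaf v u' T'.1 :=
    congrArg Subtype.val h
  have hu : u = u' := by
    have := congrArg (fun G ↦ G.neighborSet v) h'
    simpa only [neighborSet_attachLeaf, Set.singleton_eq_singleton_iff, Subtype.ext_iff] using this
  have hT : T = T' := by
    have := congrArg (fun G ↦ G.induce {v}ᶜ) h'
    simpa only [induce_attachLeaf, Subtype.ext_iff] using this
  rw [hu, hT]

lemma LabelledTree.exists_attachLeaf_eq {V : Type} [Finite V] {v : V} {T : LabelledTree V}
    (hv : Nat.card (T.1.neighborSet v) = 1) : ∃ p, attachLeaf v p = T := by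
  classical
  have := Fintype.ofFinite V
  obtain ⟨u, hu⟩ := Set.ncard_eq_one.1 hv
  have huv : T.1.Adj v u := by rw [← mem_neighborSet, hu, Set.mem_singleton_iff]
  refine ⟨(⟨u, huv.ne'⟩, ⟨T.1.induce {v}ᶜ, ?_, T.2.2.induce _⟩), Subtype.ext ?_⟩
  · exact T.2.1.induce_compl_singleton_of_degree_eq_one
      (by rwa [← card_neighborSet_eq_degree, ← Nat.card_eq_fintype_card])
  · exact attachLeaf_induce (u := ⟨u, huv.ne'⟩) hu

lemma natCard_fiber_eq_sum {ι V : Type} [Fintype ι] [DecidableEq V] (f : ι → V) (w : V) :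
    Nat.card {j // f j = w} = ∑ j, if f j = w then 1 else 0 := by
  rw [Nat.card_eq_fintype_card, Fintype.card_subtype, Finset.card_filter]

/-- Prepend the value `p.1` to the finite sequence `p.2` of elements other than `v`. -/
def consAvoiding {V : Type} (v : V) (k : ℕ)
    (p : ({v}ᶜ : Set V) × (Fin k → ({v}ᶜ : Set V))) : Fin (k + 1) → V :=
  fun j ↦ (Fin.cons p.1 p.2 : Fin (k + 1) → ({v}ᶜ : Set V)) j

lemma consAvoiding_injective {V : Type} (v : V) (k : ℕ) :
    Function.Injective (consAvoiding v k) := by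
  rintro ⟨u, f⟩ ⟨u', f'⟩ h
  have := Fin.cons_injective2 (funext fun j ↦ Subtype.ext (congrFun h j) :
    (Fin.cons u f : Fin (k + 1) → ({v}ᶜ : Set V)) = Fin.cons u' f')
  rw [this.1, this.2]

lemma consAvoiding_ne {V : Type} {v : V} {k : ℕ}
    (p : ({v}ᶜ : Set V) × (Fin k → ({v}ᶜ : Set V))) (j : Fin (k + 1)) : consAvoiding v k p j ≠ v :=
  ((Fin.cons p.1 p.2 : Fin (k + 1) → ({v}ᶜ : Set V)) j).2

lemma exists_consAvoiding_eq {V : Type} {v : V} {k : ℕ} {f : Fin (k + 1) → V}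
    (hf : ∀ j, f j ≠ v) : ∃ p, consAvoiding v k p = f := by
  refine ⟨(⟨f 0, hf 0⟩, fun j ↦ ⟨f j.succ, hf _⟩), funext fun j ↦ ?_⟩
  cases j using Fin.cases <;> rfl

lemma natCard_fiber_consAvoiding {V : Type} [DecidableEq V] {v : V} {k : ℕ}
    (u : ({v}ᶜ : Set V)) (f : Fin k → ({v}ᶜ : Set V)) (w : ({v}ᶜ : Set V)) :
    Nat.card {j // consAvoiding v k (u, f) j = w} =
      Nat.card {j // f j = w} + if u = w then 1 else 0 := by
  rw [natCard_fiber_eq_sum, natCard_fiber_eq_sum, Fin.sum_univ_succ, add_comm]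
  simp [consAvoiding, Subtype.ext_iff]

/-- An injection `h` identifies a fiber of `s ∘ h` with the fiber of `s` if its range contains the
latter. -/
noncomputable def fiberEquivOfInjective {P A D : Type*} {h : P → A} (hh : Function.Injective h)
    (s : A → D) (d : D) (hd : ∀ a, s a = d → ∃ p, h p = a) :
    {p // s (h p) = d} ≃ {a // s a = d} :=
  Equiv.ofBijective (fun p ↦ ⟨h p.1, p.2⟩)
    ⟨fun p q hpq ↦ Subtype.ext (hh (congrArg Subtype.val hpq)), fun ⟨a, ha⟩ ↦ by
      obtain ⟨p, rfl⟩ := hd a ha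
      exact ⟨⟨p, ha⟩, rfl⟩⟩

/-- Maps with equivalent fibers are intertwined by an equivalence of their domains. -/
lemma exists_equiv_of_fiber_equiv {A B D : Type*} (s : A → D) (t : B → D)
    (h : ∀ d, Nonempty ({a // s a = d} ≃ {b // t b = d})) : ∃ e : A ≃ B, ∀ a, t (e a) = s a := by
  let φ := fun d ↦ (h d).some
  refine ⟨(Equiv.sigmaFiberEquiv s).symm.trans
    ((Equiv.sigmaCongrRight φ).trans (Equiv.sigmaFiberEquiv t)), fun a ↦ ?_⟩
  exact (φ (s a) ⟨a, rfl⟩).2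

/-- A Prüfer-type correspondence: sequences encode trees so that multiplicities give degrees. -/
lemma exists_equiv_labelledTree_degree (k : ℕ) (V : Type) [Finite V] (hV : Nat.card V = k + 2) :
    ∃ e : LabelledTree V ≃ (Fin k → V), ∀ T w,
      1 + Nat.card {j // e T j = w} = Nat.card (T.1.neighborSet w) := by
  classical
  induction k generalizing V with
  | zero =>
    have := Fintype.ofFinite V
    have : Nontrivial V := Finite.one_lt_card_iff_nontrivial.1 (by omega)
    have hadj : ∀ T : LabelledTree V, T.1 = ⊤ := by
      intro T
      ext a b
      refine ⟨fun h ↦ h.ne, fun hab ↦ ?_⟩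
      obtain ⟨c, hc⟩ := T.2.1.preconnected.exists_adj_of_nontrivial a
      have hu : ({a, b} : Finset V) = Finset.univ := by
        rw [← Finset.card_eq_iff_eq_univ, Finset.card_pair hab, ← Nat.card_eq_fintype_card, hV]
      have hcm : c ∈ ({a, b} : Finset V) := hu ▸ Finset.mem_univ c
      have := hc.ne
      grind
    let T₀ : LabelledTree V := ⟨⊤, connected_top, .of_card_le_two (by
      rw [ENat.card_eq_coe_natCard, hV]; rfl)⟩
    have : Unique (LabelledTree V) := ⟨⟨T₀⟩, fun T ↦ Subtype.ext (hadj T)⟩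
    refine ⟨Equiv.ofUnique _ _, fun T w ↦ ?_⟩
    rw [hadj T, Nat.card_eq_fintype_card (α := neighborSet _ _), card_neighborSet_eq_degree,
      complete_graph_degree, ← Nat.card_eq_fintype_card, hV]
    simp
  | succ k ih =>
    have := Fintype.ofFinite V
    have : Nontrivial V := Finite.one_lt_card_iff_nontrivial.1 (by omega)
    suffices h : ∃ e : LabelledTree V ≃ (Fin (k + 1) → V), ∀ T,
        (fun w ↦ 1 + Nat.card {j // e T j = w}) = fun w ↦ Nat.card (T.1.neighborSet w) from
      h.imp fun e he T w ↦ congrFun (he T) w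
    refine exists_equiv_of_fiber_equiv (fun (T : LabelledTree V) w ↦ Nat.card (T.1.neighborSet w))
      (fun (f : Fin (k + 1) → V) w ↦ 1 + Nat.card {j // f j = w}) fun d ↦ ?_
    by_cases hd : ∃ v, d v = 1
    · obtain ⟨v, hv⟩ := hd
      have hcard : Nat.card ({v}ᶜ : Set V) = k + 2 := by
        rw [Nat.card_eq_fintype_card, Fintype.card_compl_set, ← Nat.card_eq_fintype_card, hV]
        simp
      obtain ⟨e, he⟩ := ih ({v}ᶜ : Set V) hcard
      refine ⟨(fiberEquivOfInjective (LabelledTree.attachLeaf_injective v) _ d ?_).symm.trans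
        (((Equiv.prodCongr (Equiv.refl _) e).subtypeEquiv fun ⟨u, T⟩ ↦ ?_).trans
        (fiberEquivOfInjective (consAvoiding_injective v k) _ d ?_))⟩
      · rintro T rfl
        exact LabelledTree.exists_attachLeaf_eq hv
      · rintro f rfl
        refine exists_consAvoiding_eq fun j hj ↦ ?_
        have : Nonempty {j // f j = v} := ⟨⟨j, hj⟩⟩
        have hpos := Nat.card_pos (α := {j // f j = v})
        have hv : 1 + Nat.card {j // f j = v} = 1 := hv
        omega
      · refine Eq.congr_left (funext fun w ↦ ?_)
        by_cases hw : w = v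
        · subst hw
          have hempty : IsEmpty {j // consAvoiding w k (u, e T) j = w} :=
            ⟨fun j ↦ consAvoiding_ne _ _ j.2⟩
          change Nat.card ((SimpleGraph.attachLeaf w u T.1).neighborSet w) =
            1 + Nat.card {j // consAvoiding w k (u, e T) j = w}
          rw [neighborSet_attachLeaf]
          simp
        · change Nat.card ((SimpleGraph.attachLeaf v u T.1).neighborSet w) =
            1 + Nat.card {j // consAvoiding v k (u, e T) j = w}
          rw [card_neighborSet_eq_induce_compl_singleton neighborSet_attachLeaf ⟨w, hw⟩,
            induce_attachLeaf, natCard_fiber_consAvoiding u (e T) ⟨w, hw⟩, ← he, add_assoc]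
    · have : IsEmpty {T : LabelledTree V // (fun w ↦ Nat.card (T.1.neighborSet w)) = d} := by
        refine ⟨fun ⟨T, hT⟩ ↦ hd ?_⟩
        obtain ⟨v, hv⟩ := (IsTree.mk T.2.1 T.2.2).exists_vert_degree_one_of_nontrivial
        exact ⟨v, by rw [← hT, ← hv, ← card_neighborSet_eq_degree, ← Nat.card_eq_fintype_card]⟩
      have : IsEmpty {f : Fin (k + 1) → V // (fun w ↦ 1 + Nat.card {j // f j = w}) = d} := by
        refine ⟨fun ⟨f, hf⟩ ↦ hd ?_⟩
        have hns : ¬ Function.Surjective f := fun h ↦ by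
          have := Nat.card_le_card_of_surjective f h
          rw [hV, Nat.card_fin] at this
          omega
        obtain ⟨v, hv⟩ := not_forall.1 hns
        have : IsEmpty {j // f j = v} := ⟨fun j ↦ hv ⟨j.1, j.2⟩⟩
        exact ⟨v, by rw [← hf]; simp⟩
      exact ⟨Equiv.equivOfIsEmpty _ _⟩

lemma natCard_interiorDom {n : ℕ} (hn : 2 ≤ n) : Nat.card (InteriorDom n) = n - 2 := by
  classical
  unfold InteriorDom
  rw [Nat.card_eq_fintype_card, Fintype.card_subtype]
  have : (Finset.univ.filter fun j : Fin n ↦ (j : ℕ) ≠ 0 ∧ (j : ℕ) ≠ n - 1) =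
      (({⟨0, by omega⟩, ⟨n - 1, by omega⟩} : Finset (Fin n)))ᶜ := by
    ext j
    simp [Fin.ext_iff]
  rw [this, Finset.card_compl, Finset.card_pair (by simp [Fin.ext_iff]; omega), Fintype.card_fin]

theorem exists_bijection_functions_to_trees_degree (n : ℕ) (hn : 2 ≤ n) :
    ∃ Θ : (InteriorDom n → Fin n) → TreeOn n,
      Function.Bijective Θ ∧
      ∀ (f : InteriorDom n → Fin n) (i : Fin n),
        Nat.card ((Θ f).1.neighborSet i) = 1 + Nat.card {j : InteriorDom n // f j = i} := by
  obtain ⟨e, he⟩ := exists_equiv_labelledTree_degree (n - 2) (Fin n) (by rw [Nat.card_fin]; omega)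
  have : Finite (InteriorDom n) := Subtype.finite
  let σ : InteriorDom n ≃ Fin (n - 2) := Finite.equivFinOfCardEq (natCard_interiorDom hn)
  let Θ : (InteriorDom n → Fin n) ≃ TreeOn n := (σ.arrowCongr (Equiv.refl _)).trans e.symm
  refine ⟨Θ, Θ.bijective, fun f i ↦ ?_⟩
  have hΘ : e (Θ f) = f ∘ σ.symm := e.apply_symm_apply _
  refine (he (Θ f) i).symm.trans ?_
  rw [hΘ]
  exact congrArg (1 + ·) (Nat.card_congr (σ.symm.subtypeEquiv fun _ ↦ Iff.rfl))
end

section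
/- For every natural number n ≥ 2, the number of trees on the vertex set {1, ..., n} equals n^(n-2). -/
universe u

theorem Nat.sum_range_choose_mul_pow_mul_pow (m x y : ℕ) :
    (∑ j ∈ Finset.range (m + 2), (m + 1).choose j * (x ^ j * (j * y ^ (m + 1 - j)))) =
      (m + 1) * x * (x + y) ^ m := by
  rw [Finset.sum_range_succ', add_pow, Finset.mul_sum]
  simp only [zero_mul, mul_zero, add_zero]
  refine Finset.sum_congr rfl fun j _ ↦ ?_
  have := Nat.add_one_mul_choose_eq m j
  rw [Nat.add_sub_add_right]
  zify at this ⊢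
  linear_combination -(x ^ (j + 1) * y ^ (m - j) : ℤ) * this

/-- Following the parent map `f`, the vertex `a` eventually arrives at a root, where `α` is the
type of non-root vertices and `β` is the type of roots. -/
inductive ReachesRoot {α β : Type*} (f : α → α ⊕ β) : α → Prop
  | root {a : α} {b : β} (h : f a = Sum.inr b) : ReachesRoot f a
  | parent {a a' : α} (h : f a = Sum.inl a') (h' : ReachesRoot f a') : ReachesRoot f a

/-- Rooted forests, presented by parent maps, with non-root vertices `α` and roots `β`. -/
def RootedForest (α β : Type*) : Type _ :=
  {f : α → α ⊕ β // ∀ a, ReachesRoot f a}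

namespace RootedForest

variable {α β : Type*}

instance [Finite α] [Finite β] : Finite (RootedForest α β) :=
  inferInstanceAs (Finite {f : α → α ⊕ β // ∀ a, ReachesRoot f a})

theorem isEmpty [Nonempty α] [IsEmpty β] : IsEmpty (RootedForest α β) := by
  refine ⟨fun ⟨f, hf⟩ ↦ ?_⟩
  have key : ∀ a, ReachesRoot f a → False := by
    intro a ha
    induction ha with
    | root h => exact isEmptyElim ‹β›
    | parent _ _ ih => exact ih
  exact key (Classical.arbitrary α) (hf _)

section Glue

open Classical in
/-- Attach a forest with roots `A` to the roots `β` by a map `A → β`. -/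
noncomputable def glueFun (A : Finset α) (g : {a // a ∈ A} → β)
    (h : {a // a ∉ A} → {a // a ∉ A} ⊕ {a // a ∈ A}) (a : α) : α ⊕ β :=
  if ha : a ∈ A then Sum.inr (g ⟨a, ha⟩)
  else Sum.inl (Sum.elim Subtype.val Subtype.val (h ⟨a, ha⟩))

variable {A : Finset α} {g : {a // a ∈ A} → β} {h : {a // a ∉ A} → {a // a ∉ A} ⊕ {a // a ∈ A}}

theorem glueFun_of_mem {a : α} (ha : a ∈ A) : glueFun A g h a = Sum.inr (g ⟨a, ha⟩) :=
  dif_pos ha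

theorem glueFun_of_notMem {a : α} (ha : a ∉ A) :
    glueFun A g h a = Sum.inl (Sum.elim Subtype.val Subtype.val (h ⟨a, ha⟩)) :=
  dif_neg ha

theorem isRight_glueFun {a : α} : (glueFun A g h a).isRight ↔ a ∈ A := by
  by_cases ha : a ∈ A
  · simp [glueFun_of_mem ha, ha]
  · simp [glueFun_of_notMem ha, ha]

theorem elim_val_val_injective :
    Function.Injective (Sum.elim Subtype.val Subtype.val : {a // a ∉ A} ⊕ {a // a ∈ A} → α) :=
  Subtype.val_injective.sumElim Subtype.val_injective fun a b hab ↦ a.2 (hab ▸ b.2)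

theorem reachesRoot_glueFun (hh : ∀ a, ReachesRoot h a) (a : α) :
    ReachesRoot (glueFun A g h) a := by
  by_cases ha : a ∈ A
  · exact .root (glueFun_of_mem ha)
  suffices ∀ x : {a // a ∉ A}, ReachesRoot h x → ReachesRoot (glueFun A g h) x from
    this ⟨a, ha⟩ (hh _)
  intro x hx
  induction hx with
  | @root a b hb =>
    refine .parent (a' := b) ?_ (.root (glueFun_of_mem b.2))
    simp [glueFun_of_notMem a.2, hb]
  | @parent a a' ha' _ ih =>
    refine .parent (a' := a') ?_ ih
    simp [glueFun_of_notMem a.2, ha']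

/-- Attach a forest with roots `A` to the roots `β` by a map `A → β`. -/
noncomputable def glue
    (x : Σ A : Finset α, ({a // a ∈ A} → β) × RootedForest {a // a ∉ A} {a // a ∈ A}) :
    RootedForest α β :=
  ⟨glueFun x.1 x.2.1 x.2.2.1, reachesRoot_glueFun x.2.2.2⟩

theorem glue_injective : Function.Injective (glue (α := α) (β := β)) := by
  rintro ⟨A, g, h, hh⟩ ⟨A', g', h', hh'⟩ heq
  have heq : glueFun A g h = glueFun A' g' h' := congrArg Subtype.val heq
  obtain rfl : A = A' := by
    ext a
    rw [← isRight_glueFun (g := g) (h := h), heq, isRight_glueFun]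
  obtain rfl : g = g' := by
    ext ⟨a, ha⟩
    simpa [glueFun_of_mem ha] using congrFun heq a
  obtain rfl : h = h' := by
    funext ⟨a, ha⟩
    have := congrFun heq a
    rw [glueFun_of_notMem ha, glueFun_of_notMem ha] at this
    exact elim_val_val_injective (Sum.inl_injective this)
  rfl

theorem glue_surjective [Finite α] : Function.Surjective (glue (α := α) (β := β)) := by
  classical
  have := Fintype.ofFinite α
  rintro ⟨f, hf⟩
  set A : Finset α := {a | (f a).isRight} with hA
  have hg : ∀ a : {a // a ∈ A}, ∃ b, f a = Sum.inr b := fun ⟨a, ha⟩ ↦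
    Sum.isRight_iff.1 (by simpa [hA] using ha)
  have hh : ∀ a : {a // a ∉ A}, ∃ s : {a // a ∉ A} ⊕ {a // a ∈ A},
      f a = Sum.inl (Sum.elim Subtype.val Subtype.val s) := by
    rintro ⟨a, ha⟩
    obtain ⟨a', ha'⟩ := Sum.isLeft_iff.1 (by simpa [hA] using ha : (f a).isLeft)
    by_cases h : a' ∈ A
    · exact ⟨.inr ⟨a', h⟩, ha'⟩
    · exact ⟨.inl ⟨a', h⟩, ha'⟩
  choose g hg using hg
  choose h hh using hh
  have hreach : ∀ a, ReachesRoot f a → ∀ ha : a ∉ A, ReachesRoot h ⟨a, ha⟩ := by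
    intro a hfa
    induction hfa with
    | @root a b hb => exact fun ha ↦ absurd (by simp [hA, hb]) ha
    | @parent a a' ha' _ ih =>
      intro ha
      have hs := hh ⟨a, ha⟩
      rw [ha'] at hs
      rcases hha : h ⟨a, ha⟩ with s | s
      · rw [hha] at hs
        obtain rfl : a' = s := Sum.inl_injective hs
        exact .parent hha (ih s.2)
      · exact .root hha
  refine ⟨⟨A, g, h, fun a ↦ hreach a (hf a) a.2⟩, Subtype.ext (funext fun a ↦ ?_)⟩
  by_cases ha : a ∈ A
  · exact (glueFun_of_mem ha).trans (hg ⟨a, ha⟩).symm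
  · exact (glueFun_of_notMem ha).trans (hh ⟨a, ha⟩).symm

theorem card_eq_sum [Fintype α] [Fintype β] :
    Nat.card (RootedForest α β) = ∑ A : Finset α,
      Fintype.card β ^ A.card * Nat.card (RootedForest {a // a ∉ A} {a // a ∈ A}) := by
  rw [← Nat.card_congr (Equiv.ofBijective glue ⟨glue_injective, glue_surjective⟩),
    Nat.card_sigma]
  refine Finset.sum_congr rfl fun A _ ↦ ?_
  simp [Nat.card_prod, Nat.card_fun]

end Glue

/-- There are `k * (m + k) ^ (m - 1)` rooted forests with `k` given roots and `m` other
vertices. -/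
theorem card_mul_add {α β : Type u} [Fintype α] [Fintype β] :
    Nat.card (RootedForest α β) * (Fintype.card α + Fintype.card β) =
      Fintype.card β * (Fintype.card α + Fintype.card β) ^ Fintype.card α := by
  classical
  induction hm : Fintype.card α using Nat.strong_induction_on generalizing α β with
  | _ m ih =>
  cases isEmpty_or_nonempty β
  · obtain rfl | hpos := Nat.eq_zero_or_pos m
    · simp
    · have : Nonempty α := Fintype.card_pos_iff.1 (hm ▸ hpos)
      have := RootedForest.isEmpty (α := α) (β := β)
      simp
  obtain _ | m := m
  · have := Fintype.card_eq_zero_iff.1 hm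
    have : Unique (RootedForest α β) :=
      ⟨⟨⟨isEmptyElim, isEmptyElim⟩⟩, fun _ ↦ Subtype.ext (Subsingleton.elim _ _)⟩
    simp
  have hA : ∀ A : Finset α, Nat.card (RootedForest {a // a ∉ A} {a // a ∈ A}) * (m + 1) =
      A.card * (m + 1) ^ (m + 1 - A.card) := by
    intro A
    have hc : Fintype.card {a // a ∉ A} = m + 1 - A.card := by
      rw [Fintype.card_subtype_compl, hm, Fintype.card_coe]
    obtain rfl | hne := A.eq_empty_or_nonempty
    · have : Nonempty {a : α // a ∉ (∅ : Finset α)} := Fintype.card_pos_iff.1 (by rw [hc]; simp)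
      have : IsEmpty {a : α // a ∈ (∅ : Finset α)} := ⟨fun a ↦ Finset.notMem_empty _ a.2⟩
      have := RootedForest.isEmpty (α := {a : α // a ∉ (∅ : Finset α)})
        (β := {a : α // a ∈ (∅ : Finset α)})
      rw [Nat.card_of_isEmpty, Finset.card_empty, zero_mul, zero_mul]
    · have hle : A.card ≤ m + 1 := hm ▸ A.card_le_univ
      have := ih (m + 1 - A.card) (by have := hne.card_pos; omega) hc
        (β := {a // a ∈ A})
      rwa [Fintype.card_coe, Nat.sub_add_cancel hle] at this
  have hsum : Nat.card (RootedForest α β) * (m + 1) =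
      (m + 1) * Fintype.card β * (Fintype.card β + (m + 1)) ^ m := by
    rw [card_eq_sum, Finset.sum_mul, ← Nat.sum_range_choose_mul_pow_mul_pow]
    simp only [mul_assoc, hA]
    rw [← Finset.powerset_univ,
      Finset.sum_powerset_apply_card
        (fun j ↦ Fintype.card β ^ j * (j * (m + 1) ^ (m + 1 - j)))]
    simp [hm]
  have : Nat.card (RootedForest α β) = Fintype.card β * (Fintype.card β + (m + 1)) ^ m :=
    Nat.eq_of_mul_eq_mul_right m.succ_pos (by rw [hsum, Nat.succ_eq_add_one]; ring)
  rw [this]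
  ring

/-- The graph joining each vertex to its parent. -/
def toGraph (F : RootedForest α β) : SimpleGraph (α ⊕ β) :=
  .fromEdgeSet (Set.range fun a ↦ s(Sum.inl a, F.1 a))

theorem apply_ne_inl_self (F : RootedForest α β) (a : α) : F.1 a ≠ Sum.inl a := by
  intro h
  have key : ∀ x, ReachesRoot F.1 x → x ≠ a := by
    intro x hx
    induction hx with
    | root hb => rintro rfl; simp [h] at hb
    | parent ha' _ ih =>
      rintro rfl
      exact ih (Sum.inl_injective (ha'.symm.trans h))
  exact key a (F.2 a) rfl

theorem apply_ne_inl_of_apply_eq_inl (F : RootedForest α β) {a a' : α}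
    (h : F.1 a = Sum.inl a') : F.1 a' ≠ Sum.inl a := by
  intro h'
  have key : ∀ x, ReachesRoot F.1 x → x ≠ a ∧ x ≠ a' := by
    intro x hx
    induction hx with
    | root hb => constructor <;> rintro rfl <;> simp_all
    | parent hp _ ih => constructor <;> rintro rfl <;> simp_all
  exact (key a (F.2 a)).1 rfl

theorem toGraph_adj (F : RootedForest α β) (a : α) : F.toGraph.Adj (Sum.inl a) (F.1 a) :=
  ⟨⟨a, rfl⟩, (F.apply_ne_inl_self a).symm⟩

theorem toGraph_injective : Function.Injective (toGraph (α := α) (β := β)) := by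
  intro F F' h
  have key : ∀ a, ReachesRoot F.1 a → F.1 a = F'.1 a := by
    intro a ha
    induction ha with
    | @root a b hb =>
      have hadj := F.toGraph_adj a
      rw [h, hb] at hadj
      obtain ⟨⟨c, hc⟩, -⟩ := hadj
      obtain ⟨hc, hc'⟩ | ⟨hc, -⟩ := Sym2.eq_iff.1 hc
      · rw [hb, ← hc', Sum.inl_injective hc]
      · cases hc
    | @parent a a' ha' _ ih =>
      have hadj := F.toGraph_adj a
      rw [h, ha'] at hadj
      obtain ⟨⟨c, hc⟩, -⟩ := hadj
      obtain ⟨hc, hc'⟩ | ⟨hc, hc'⟩ := Sym2.eq_iff.1 hc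
      · rw [ha', ← hc', Sum.inl_injective hc]
      · rw [Sum.inl_injective hc, ← ih] at hc'
        exact absurd hc' (F.apply_ne_inl_of_apply_eq_inl ha')
  exact Subtype.ext (funext fun a ↦ key a (F.2 a))

theorem toGraph_reachable [Unique β] (F : RootedForest α β) (x : α ⊕ β) :
    F.toGraph.Reachable x (Sum.inr default) := by
  obtain a | b := x
  · induction F.2 a with
    | @root a b hb => exact Subsingleton.elim default b ▸ hb ▸ (F.toGraph_adj a).reachable
    | @parent a a' ha' _ ih =>
      have := (F.toGraph_adj a).reachable
      rw [ha'] at this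
      exact this.trans ih
  · rw [Subsingleton.elim b default]

theorem toGraph_isTree [Finite α] [Unique β] (F : RootedForest α β) : F.toGraph.IsTree := by
  have hconn : F.toGraph.Connected :=
    { preconnected := fun x y ↦ (F.toGraph_reachable x).trans (F.toGraph_reachable y).symm
      nonempty := ⟨Sum.inr default⟩ }
  refine SimpleGraph.isTree_iff_connected_and_card.2 ⟨hconn, ?_⟩
  refine le_antisymm ?_ hconn.card_vert_le_card_edgeSet_add_one
  rw [Nat.card_sum, Nat.card_unique (α := β)]
  gcongr
  calc Nat.card F.toGraph.edgeSet
      ≤ Nat.card (Set.range fun a ↦ s(Sum.inl a, F.1 a)) :=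
        Nat.card_mono (Set.finite_range _) (by simp [toGraph])
    _ ≤ Nat.card α := Finite.card_range_le _

theorem exists_toGraph_eq [Finite α] [Unique β] {G : SimpleGraph (α ⊕ β)} (hG : G.IsTree) :
    ∃ F : RootedForest α β, F.toGraph = G := by
  have hstep : ∀ a : α, ∃ y, G.Adj (Sum.inl a) y ∧
      G.dist y (Sum.inr default) < G.dist (Sum.inl a) (Sum.inr default) := by
    intro a
    obtain ⟨p, hp⟩ := hG.1.exists_walk_length_eq_dist (Sum.inl a) (Sum.inr default)
    cases p with
    | cons hadj q =>
      exact ⟨_, hadj, by rw [← hp]; exact Nat.lt_succ_of_le (SimpleGraph.dist_le q)⟩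
  choose f hadj hdist using hstep
  have hreach : ∀ a, ReachesRoot f a := by
    intro a
    induction hd : G.dist (Sum.inl a) (Sum.inr default) using Nat.strong_induction_on
      generalizing a with
    | _ d ih =>
      rcases hfa : f a with a' | b
      · exact .parent hfa (ih _ (by rw [← hd, ← hfa]; exact hdist a) a' rfl)
      · exact .root hfa
  refine ⟨⟨f, hreach⟩, ?_⟩
  have hle : toGraph ⟨f, hreach⟩ ≤ G := by
    rintro x y ⟨⟨a, ha⟩, -⟩
    rw [← SimpleGraph.mem_edgeSet, ← ha]
    exact hadj a
  exact ((SimpleGraph.isTree_iff_minimal_connected.1 hG).eq_of_le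
    (toGraph_isTree _).1 hle)

end RootedForest

/-- Trees on a finite vertex set with a distinguished root correspond to parent maps. -/
theorem card_isTree_sum_unique {α β : Type*} [Finite α] [Unique β] :
    Nat.card {G : SimpleGraph (α ⊕ β) // G.IsTree} = Nat.card (RootedForest α β) :=
  (Nat.card_congr (Equiv.ofBijective (fun F ↦ ⟨F.toGraph, F.toGraph_isTree⟩)
    ⟨fun _ _ h ↦ RootedForest.toGraph_injective (congrArg Subtype.val h),
      fun G ↦ (RootedForest.exists_toGraph_eq G.2).imp fun _ ↦ Subtype.ext⟩)).symm

theorem card_isTree_congr {V W : Type*} (e : V ≃ W) :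
    Nat.card {G : SimpleGraph V // G.IsTree} = Nat.card {G : SimpleGraph W // G.IsTree} :=
  Nat.card_congr (e.simpleGraph.subtypeEquiv fun G ↦
    (SimpleGraph.Iso.comap e.symm G).isTree_iff.symm)

/-- Cayley's formula: the number of trees on the vertex set `{1, ..., n}`
(connected acyclic simple graphs on `Fin n`) is `n ^ (n - 2)`. -/
theorem card_trees_eq_pow (n : ℕ) (hn : 2 ≤ n) :
    Nat.card {G : SimpleGraph (Fin n) // G.Connected ∧ G.IsAcyclic} = n ^ (n - 2) := by
  obtain ⟨m, rfl⟩ := Nat.exists_eq_add_of_le' hn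
  have h : Nat.card {G : SimpleGraph (Fin (m + 2)) // G.IsTree} =
      Nat.card (RootedForest (Fin (m + 1)) Unit) :=
    (card_isTree_congr ((finSuccEquivLast).trans (Equiv.optionEquivSumPUnit _))).trans
      card_isTree_sum_unique
  have hcard := RootedForest.card_mul_add (α := Fin (m + 1)) (β := Unit)
  simp only [← SimpleGraph.isTree_iff, h]
  simp only [Fintype.card_fin, Fintype.card_unit, one_mul, add_assoc, Nat.reduceAdd] at hcard
  rw [pow_succ] at hcard
  exact Nat.eq_of_mul_eq_mul_right (Nat.succ_pos _) hcard
end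

section
/- Let n ≥ 2 and let s_1, ..., s_n be positive integers with s_1 + s_2 + ... + s_n = 2n - 2. Then the number of trees T on the vertex set {1, ..., n} such that the degree of vertex i in T equals s_i for every i ∈ {1, ..., n} is the multinomial coefficient (n-2)! / ((s_1 - 1)! (s_2 - 1)! ⋯ (s_n - 1)!). -/
namespace SimpleGraph

/-- The graph obtained from `H` by attaching a new leaf `none` to the vertex `w`. -/
def addLeaf {W : Type*} (H : SimpleGraph W) (w : W) : SimpleGraph (Option W) where
  Adj
    | none, none => False
    | none, some x => x = w
    | some x, none => x = w
    | some x, some y => H.Adj x y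
  symm := ⟨by
    rintro (_ | x) (_ | y) h
    · exact h
    · exact h
    · exact h
    · exact H.symm.symm _ _ h⟩
  loopless := ⟨by
    rintro (_ | x) h
    · exact h
    · exact H.loopless.irrefl x h⟩

section AddLeaf

variable {W : Type*} (H : SimpleGraph W) (w : W)

@[simp] lemma addLeaf_adj_none_some (x : W) : (H.addLeaf w).Adj none (some x) ↔ x = w := Iff.rfl

@[simp] lemma addLeaf_adj_some_none (x : W) : (H.addLeaf w).Adj (some x) none ↔ x = w := Iff.rfl

@[simp] lemma addLeaf_adj_some_some (x y : W) :
    (H.addLeaf w).Adj (some x) (some y) ↔ H.Adj x y := Iff.rfl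

lemma addLeaf_comap_some : (H.addLeaf w).comap some = H := by
  ext x y
  simp

lemma neighborSet_addLeaf_none : (H.addLeaf w).neighborSet none = {some w} := by
  ext (_ | x) <;> simp

lemma addLeaf_comap_of_neighborSet_none {G : SimpleGraph (Option W)} {w : W}
    (h : G.neighborSet none = {some w}) : (G.comap some).addLeaf w = G := by
  have h' : ∀ x, G.Adj none (some x) ↔ x = w := fun x ↦ by
    rw [← mem_neighborSet, h]
    simp
  ext (_ | x) (_ | y)
  · simp
  · simp [h']
  · simp [G.adj_comm (some x), h']
  · simp

lemma ncard_neighborSet_addLeaf_some [Finite W] [DecidableEq W] (x : W) :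
    ((H.addLeaf w).neighborSet (some x)).ncard =
      (H.neighborSet x).ncard + if x = w then 1 else 0 := by
  split_ifs with hx
  · have : (H.addLeaf w).neighborSet (some x) = insert none (some '' H.neighborSet x) := by
      ext (_ | y) <;> simp [hx]
    rw [this, Set.ncard_insert_of_notMem (by simp),
      Set.ncard_image_of_injective _ (Option.some_injective W)]
  · have : (H.addLeaf w).neighborSet (some x) = some '' H.neighborSet x := by
      ext (_ | y) <;> simp [hx]
    rw [this, Set.ncard_image_of_injective _ (Option.some_injective W), add_zero]

lemma Reachable.getD_of_addLeaf {u v : Option W} (h : (H.addLeaf w).Reachable u v) :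
    H.Reachable (u.getD w) (v.getD w) := by
  obtain ⟨p⟩ := h
  induction p with
  | nil => exact Reachable.refl _
  | @cons a b _ hab _ ih =>
    refine Reachable.trans ?_ ih
    rcases a with _ | a <;> rcases b with _ | b
    · exact Reachable.refl _
    · rw [(addLeaf_adj_none_some H w b).1 hab]
      exact Reachable.refl _
    · rw [(addLeaf_adj_some_none H w a).1 hab]
      exact Reachable.refl _
    · exact Adj.reachable ((addLeaf_adj_some_some H w a b).1 hab)

lemma connected_addLeaf_iff : (H.addLeaf w).Connected ↔ H.Connected := by
  constructor
  · intro h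
    have : Nonempty W := ⟨w⟩
    exact ⟨fun x y ↦ (h.preconnected (some x) (some y)).getD_of_addLeaf⟩
  · intro h
    have hw : ∀ u, (H.addLeaf w).Reachable u (some w) := by
      rintro (_ | x)
      · exact Adj.reachable ((addLeaf_adj_none_some H w w).2 rfl)
      · exact (h.preconnected x w).map (⟨some, fun h ↦ h⟩ : H →g H.addLeaf w)
    exact ⟨fun u v ↦ (hw u).trans (hw v).symm⟩

end AddLeaf

/-- The connected graphs on `V` in which each vertex `i` has degree `s i`. -/
def ConnectedWithDegrees (V : Type*) (s : V → ℕ) : Type _ :=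
  {G : SimpleGraph V // G.Connected ∧ ∀ i, (G.neighborSet i).ncard = s i}

instance (V : Type*) [Finite V] (s : V → ℕ) : Finite (ConnectedWithDegrees V s) :=
  inferInstanceAs (Finite {_G : SimpleGraph V // _})

lemma card_connectedWithDegrees_comp_equiv {V V' : Type*} (e : V ≃ V') (s : V' → ℕ) :
    Nat.card (ConnectedWithDegrees V (s ∘ e)) = Nat.card (ConnectedWithDegrees V' s) := by
  refine Nat.card_congr (e.simpleGraph.subtypeEquiv fun G ↦ ?_)
  let φ : e.simpleGraph G ≃g G := Iso.comap e.symm G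
  refine and_congr φ.connected_iff.symm (e.forall_congr fun i ↦ ?_)
  have h : (G.neighborSet i).ncard = ((e.simpleGraph G).neighborSet (e i)).ncard := by
    simp only [← Nat.card_coe_set_eq]
    exact Nat.card_congr (φ.symm.mapNeighborSet i)
  rw [h, Function.comp_apply]

/-- Removing the leaf `none` from a connected graph: summing over the vertex `w` to which it was
attached, the degree of `w` drops by one. -/
lemma card_connectedWithDegrees_option {W : Type*} [Fintype W] [DecidableEq W]
    (s : Option W → ℕ) (hpos : ∀ i, 0 < s i) (hs : s none = 1) :
    Nat.card (ConnectedWithDegrees (Option W) s) =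
      ∑ w, Nat.card (ConnectedWithDegrees W fun x ↦ s (some x) - if x = w then 1 else 0) := by
  rw [← Nat.card_sigma]
  let f : (Σ w, ConnectedWithDegrees W fun x ↦ s (some x) - if x = w then 1 else 0) →
      ConnectedWithDegrees (Option W) s := fun p ↦
    ⟨p.2.1.addLeaf p.1, (connected_addLeaf_iff _ _).2 p.2.2.1, by
      rintro (_ | x)
      · rw [neighborSet_addLeaf_none, Set.ncard_singleton, hs]
      · rw [ncard_neighborSet_addLeaf_some, p.2.2.2 x]
        have := hpos (some x)
        dsimp only
        split_ifs <;> omega⟩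
  refine (Nat.card_eq_of_bijective f ⟨?_, ?_⟩).symm
  · rintro ⟨w, H, hH⟩ ⟨w', H', hH'⟩ h
    have h : H.addLeaf w = H'.addLeaf w' := congrArg Subtype.val h
    obtain rfl : w = w' := by
      rw [← addLeaf_adj_none_some H' w' w, ← h, addLeaf_adj_none_some]
    obtain rfl : H = H' := by
      rw [← addLeaf_comap_some H w, h, addLeaf_comap_some]
    rfl
  · rintro ⟨G, hG, hdeg⟩
    obtain ⟨a, ha⟩ := Set.ncard_eq_one.1 ((hdeg none).trans hs)
    obtain _ | w := a
    · have : none ∈ G.neighborSet none := ha ▸ rfl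
      exact (G.loopless.irrefl none this).elim
    have hGw := addLeaf_comap_of_neighborSet_none ha
    refine ⟨⟨w, G.comap some, ?_, fun x ↦ ?_⟩, Subtype.ext hGw⟩
    · rwa [← connected_addLeaf_iff _ w, hGw]
    · have := ncard_neighborSet_addLeaf_some (G.comap some) w x
      rw [hGw, hdeg] at this
      exact Nat.eq_sub_of_add_eq this.symm

lemma card_connectedWithDegrees_eq_zero {V : Type*} [Nontrivial V] [Finite V] {s : V → ℕ} {v : V}
    (hv : s v = 0) : Nat.card (ConnectedWithDegrees V s) = 0 := by
  have : IsEmpty (ConnectedWithDegrees V s) := by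
    refine ⟨fun ⟨G, hG, hdeg⟩ ↦ ?_⟩
    obtain ⟨w, hw⟩ := hG.preconnected.exists_adj_of_nontrivial v
    have h := hdeg v
    rw [hv, Set.ncard_eq_zero] at h
    exact (h ▸ hw : w ∈ (∅ : Set V))
  exact Nat.card_of_isEmpty

lemma card_connectedWithDegrees_of_subsingleton {V : Type*} [Nonempty V] [Subsingleton V] :
    Nat.card (ConnectedWithDegrees V fun _ ↦ 0) = 1 := by
  rw [Nat.card_eq_one_iff_unique]
  refine ⟨⟨fun G G' ↦ Subtype.ext (Subsingleton.elim _ _)⟩,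
    ⟨⟨⊥, ⟨fun u v ↦ Subsingleton.elim u v ▸ Reachable.refl _⟩, fun i ↦ by simp⟩⟩⟩

lemma card_connectedWithDegrees_mul_prod_factorial_option {W : Type*} [Fintype W] {n : ℕ}
    (hW : Fintype.card W = n + 1) (s : Option W → ℕ) (hpos : ∀ i, 0 < s i) (hs : s none = 1)
    (hsum : ∑ i, s i = 2 * n + 2)
    (ih : ∀ m, n = m + 1 → ∀ t : W → ℕ, (∀ i, 0 < t i) → ∑ i, t i = 2 * m + 2 →
      Nat.card (ConnectedWithDegrees W t) * ∏ i, (t i - 1).factorial = m.factorial) :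
    Nat.card (ConnectedWithDegrees (Option W) s) * ∏ i, (s i - 1).factorial = n.factorial := by
  classical
  rw [card_connectedWithDegrees_option s hpos hs, Fintype.prod_option, hs]
  obtain ⟨u, hu⟩ : ∃ u : W → ℕ, ∀ x, s (some x) = u x + 1 :=
    ⟨fun x ↦ s (some x) - 1, fun x ↦ (Nat.sub_add_cancel (hpos _)).symm⟩
  have husum : ∑ x, u x = n := by
    simp only [Fintype.sum_option, hs, hu, Finset.sum_add_distrib, Finset.sum_const,
      Finset.card_univ, hW, smul_eq_mul, mul_one] at hsum
    omega
  simp only [hu, Nat.add_sub_cancel, Nat.sub_self, Nat.factorial_zero, one_mul, Finset.sum_mul]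
  rcases n with _ | m
  · have hu0 : ∀ x, u x = 0 := by simpa using husum
    obtain ⟨w, hw⟩ := Fintype.card_eq_one_iff.1 hW
    have : Subsingleton W := ⟨fun a b ↦ (hw a).trans (hw b).symm⟩
    have : Nonempty W := ⟨w⟩
    simp [hu0, Subsingleton.elim _ w, hW, card_connectedWithDegrees_of_subsingleton]
  · have hnt : Nontrivial W := Fintype.one_lt_card_iff_nontrivial.1 (by omega)
    rw [Nat.factorial_succ, ← husum, Finset.sum_mul]
    refine Finset.sum_congr rfl fun w _ ↦ ?_
    rcases hw : u w with _ | k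
    · rw [card_connectedWithDegrees_eq_zero (v := w) (by simp [hw]), zero_mul, zero_mul]
    · have hsub : ∀ x ≠ w, u x + 1 - (if x = w then 1 else 0) = u x + 1 := fun x hx ↦ by simp [hx]
      rw [← ih m rfl (fun x ↦ u x + 1 - if x = w then 1 else 0), mul_left_comm]
      · congr 1
        rw [← Finset.mul_prod_erase _ _ (Finset.mem_univ w),
          ← Finset.mul_prod_erase _ _ (Finset.mem_univ w), ← mul_assoc]
        congr 1
        · simp [hw, Nat.factorial_succ]
        · refine Finset.prod_congr rfl fun x hx ↦ ?_
          rw [hsub x (Finset.ne_of_mem_erase hx), Nat.add_sub_cancel]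
      · intro x
        by_cases hx : x = w
        · simp [hx, hw]
        · simp [hx]
      · have h1 : ∑ x, (u x + 1 - if x = w then 1 else 0) + ∑ x, (if x = w then 1 else 0) =
            ∑ x, (u x + 1) := by
          rw [← Finset.sum_add_distrib]
          refine Finset.sum_congr rfl fun x _ ↦ ?_
          split_ifs <;> omega
        simp only [Finset.sum_ite_eq', Finset.mem_univ, if_true, Finset.sum_add_distrib, husum,
          Finset.sum_const, Finset.card_univ, hW, smul_eq_mul, mul_one] at h1
        omega

theorem card_connectedWithDegrees_mul_prod_factorial {V : Type*} [Fintype V] {n : ℕ}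
    (hV : Fintype.card V = n + 2) (s : V → ℕ) (hpos : ∀ i, 0 < s i)
    (hsum : ∑ i, s i = 2 * n + 2) :
    Nat.card (ConnectedWithDegrees V s) * ∏ i, (s i - 1).factorial = n.factorial := by
  classical
  induction n using Nat.strong_induction_on generalizing V with
  | _ n ih =>
    obtain ⟨v, hv⟩ : ∃ v, s v = 1 := by
      by_contra! h
      have : ∑ _i : V, 2 ≤ ∑ i, s i := Finset.sum_le_sum fun i _ ↦ by
        have := hpos i
        have := h i
        omega
      simp only [Finset.sum_const, Finset.card_univ, hV, smul_eq_mul] at this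
      omega
    let e : Option {x // x ≠ v} ≃ V := Equiv.optionSubtypeNe v
    have hW : Fintype.card {x // x ≠ v} = n + 1 := by
      have := Fintype.card_congr e
      rw [Fintype.card_option] at this
      omega
    rw [← card_connectedWithDegrees_comp_equiv e s, ← e.prod_comp fun i ↦ (s i - 1).factorial]
    refine card_connectedWithDegrees_mul_prod_factorial_option hW (s ∘ e) (fun _ ↦ hpos _) ?_ ?_ ?_
    · simpa [e] using hv
    · rw [← hsum, ← e.sum_comp s]
      rfl
    · rintro m rfl t ht htsum
      exact ih m (Nat.lt_succ_self m) hW t ht htsum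

lemma Connected.isTree_of_sum_ncard_neighborSet {V : Type*} [Fintype V] {G : SimpleGraph V}
    (hG : G.Connected) (h : ∑ i, (G.neighborSet i).ncard + 2 = 2 * Fintype.card V) : G.IsTree := by
  classical
  have hdeg : ∀ i, (G.neighborSet i).ncard = G.degree i := fun i ↦ by
    rw [← Nat.card_coe_set_eq, Nat.card_eq_fintype_card, card_neighborSet_eq_degree]
  simp only [hdeg, G.sum_degrees_eq_twice_card_edges] at h
  rw [isTree_iff_connected_and_card]
  refine ⟨hG, ?_⟩
  rw [Nat.card_eq_fintype_card, ← edgeFinset_card, Nat.card_eq_fintype_card]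
  omega

end SimpleGraph

/-- The number of trees on `{1, ..., n}` with degree sequence `s₁, ..., sₙ`
(where each `sᵢ ≥ 1` and `∑ sᵢ = 2n - 2`) is the multinomial coefficient
`(n-2)! / ((s₁-1)! ⋯ (sₙ-1)!)`. -/
theorem card_trees_with_degree_sequence (n : ℕ) (hn : 2 ≤ n) (s : Fin n → ℕ)
    (hpos : ∀ i, 0 < s i) (hsum : ∑ i, s i = 2 * n - 2) :
    Nat.card {G : SimpleGraph (Fin n) // G.Connected ∧ G.IsAcyclic ∧
        ∀ i : Fin n, Nat.card (G.neighborSet i) = s i}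
      = (n - 2).factorial / ∏ i : Fin n, (s i - 1).factorial := by
  obtain ⟨m, rfl⟩ : ∃ m, n = m + 2 := ⟨_, (Nat.sub_add_cancel hn).symm⟩
  have hsum' : ∑ i, s i = 2 * m + 2 := by omega
  rw [Nat.add_sub_cancel,
    ← SimpleGraph.card_connectedWithDegrees_mul_prod_factorial (Fintype.card_fin _) s hpos hsum',
    Nat.mul_div_cancel _ (Finset.prod_pos fun i _ ↦ Nat.factorial_pos _)]
  refine Nat.card_congr (Equiv.subtypeEquivRight fun G ↦ ?_)
  simp only [Nat.card_coe_set_eq]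
  refine ⟨fun h ↦ ⟨h.1, h.2.2⟩, fun h ↦ ⟨h.1, ?_, h.2⟩⟩
  refine (h.1.isTree_of_sum_ncard_neighborSet ?_).isAcyclic
  simp only [h.2, hsum', Fintype.card_fin]
  omega
end

section
/- Let n ≥ 2 and let R be a commutative ring with elements x_1, ..., x_n ∈ R. Then the sum, over all trees T on the vertex set {1, ..., n}, of the product ∏_{i=1}^{n} x_i^(deg_T(i) - 1) equals (x_1 + x_2 + ... + x_n)^(n-2). -/
namespace SimpleGraph

/-- The graph obtained from a graph `G` on `Fin m` by inserting a new vertex at position `v`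
that is adjacent only to (the image of) `u`. -/
def insertLeaf {m : ℕ} (v : Fin (m + 1)) (G : SimpleGraph (Fin m)) (u : Fin m) :
    SimpleGraph (Fin (m + 1)) :=
  G.map v.succAboveEmb ⊔ edge v (v.succAbove u)

section InsertLeaf

variable {m : ℕ} {v : Fin (m + 1)} {G : SimpleGraph (Fin m)} {u : Fin m}

lemma insertLeaf_adj_succAbove {a b : Fin m} :
    (insertLeaf v G u).Adj (v.succAbove a) (v.succAbove b) ↔ G.Adj a b := by
  have h : (G.map v.succAboveEmb).Adj (v.succAbove a) (v.succAbove b) ↔ G.Adj a b :=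
    map_adj_apply (f := v.succAboveEmb)
  rw [insertLeaf, sup_adj, h]
  simp [edge_adj, Fin.succAbove_ne]

lemma not_map_succAboveEmb_adj_self (w : Fin (m + 1)) : ¬ (G.map v.succAboveEmb).Adj v w := by
  rw [map_adj]
  rintro ⟨a, -, -, ha, -⟩
  exact Fin.succAbove_ne v a ha

lemma insertLeaf_adj_self {a : Fin m} :
    (insertLeaf v G u).Adj v (v.succAbove a) ↔ a = u := by
  rw [insertLeaf, sup_adj, or_iff_right (not_map_succAboveEmb_adj_self _)]
  simp [edge_adj, Fin.succAbove_ne, Fin.ne_succAbove]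

lemma comap_insertLeaf : (insertLeaf v G u).comap v.succAboveEmb = G := by
  ext a b
  exact insertLeaf_adj_succAbove

lemma card_neighborSet_insertLeaf_self :
    Nat.card ((insertLeaf v G u).neighborSet v) = 1 := by
  rw [Nat.card_coe_set_eq, Set.ncard_eq_one]
  refine ⟨v.succAbove u, ?_⟩
  ext w
  rcases Fin.eq_self_or_eq_succAbove v w with rfl | ⟨a, rfl⟩
  · simp [Fin.ne_succAbove]
  · simp [insertLeaf_adj_self]

lemma card_neighborSet_insertLeaf_succAbove (a : Fin m) :
    Nat.card ((insertLeaf v G u).neighborSet (v.succAbove a)) =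
      Nat.card (G.neighborSet a) + if a = u then 1 else 0 := by
  have himage : (v.succAbove '' G.neighborSet a).ncard = (G.neighborSet a).ncard :=
    Set.ncard_image_of_injective _ Fin.succAbove_right_injective
  have hv : v ∉ v.succAbove '' G.neighborSet a := by simp [Fin.succAbove_ne]
  rw [Nat.card_coe_set_eq, Nat.card_coe_set_eq, ← himage]
  split_ifs with h
  · rw [← Set.ncard_insert_of_notMem hv]
    congr 1
    ext w
    rcases Fin.eq_self_or_eq_succAbove v w with rfl | ⟨b, rfl⟩
    · simp [adj_comm, insertLeaf_adj_self, h]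
    · simp [insertLeaf_adj_succAbove, Fin.succAbove_ne]
  · rw [add_zero]
    congr 1
    ext w
    rcases Fin.eq_self_or_eq_succAbove v w with rfl | ⟨b, rfl⟩
    · simp [adj_comm, insertLeaf_adj_self, h, Fin.succAbove_ne]
    · simp [insertLeaf_adj_succAbove]

lemma IsTree.insertLeaf (hG : G.IsTree) (v : Fin (m + 1)) (u : Fin m) :
    (G.insertLeaf v u).IsTree := by
  classical
  rw [isTree_iff_connected_and_card]
  constructor
  · refine connected_iff_exists_forall_reachable _ |>.mpr ⟨v, fun w ↦ ?_⟩
    have huv : (G.insertLeaf v u).Reachable v (v.succAbove u) :=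
      (insertLeaf_adj_self.mpr rfl).reachable
    rcases Fin.eq_self_or_eq_succAbove v w with rfl | ⟨a, rfl⟩
    · rfl
    · exact huv.trans <| (hG.connected.preconnected u a).map
        (⟨v.succAbove, insertLeaf_adj_succAbove.mpr⟩ : G →g G.insertLeaf v u)
  · have hcard := hG.card_edgeFinset
    have hnadj : ¬ (G.map v.succAboveEmb).Adj v (v.succAbove u) :=
      not_map_succAboveEmb_adj_self _
    have hmap := card_edgeFinset_map v.succAboveEmb G
    have hinsert := card_edgeFinset_sup_edge _ hnadj (Fin.ne_succAbove v u)
    simp only [edgeFinset_card, ← Nat.card_eq_fintype_card] at hcard hmap hinsert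
    rw [SimpleGraph.insertLeaf, hinsert, hmap, hcard]
    simp

end InsertLeaf

lemma IsTree.comap_succAboveEmb {m : ℕ} {v : Fin (m + 1)} {G : SimpleGraph (Fin (m + 1))}
    (hG : G.IsTree) (hv : Nat.card (G.neighborSet v) = 1) :
    (G.comap v.succAboveEmb).IsTree := by
  classical
  refine ⟨?_, hG.isAcyclic.of_comap _⟩
  have hdeg : G.degree v = 1 := by
    rwa [← card_neighborSet_eq_degree, ← Nat.card_eq_fintype_card]
  let e : G.comap v.succAboveEmb ≃g G.induce {v}ᶜ :=
    ⟨finSuccAboveEquiv v, Iff.rfl⟩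
  exact e.connected_iff.mpr (hG.connected.induce_compl_singleton_of_degree_eq_one hdeg)

lemma exists_insertLeaf_eq {m : ℕ} {v : Fin (m + 1)} {G : SimpleGraph (Fin (m + 1))}
    (hv : Nat.card (G.neighborSet v) = 1) :
    ∃ u, insertLeaf v (G.comap v.succAboveEmb) u = G := by
  rw [Nat.card_coe_set_eq, Set.ncard_eq_one] at hv
  obtain ⟨w, hw⟩ := hv
  have hadj (b) : G.Adj v b ↔ b = w := by
    rw [← mem_neighborSet, hw, Set.mem_singleton_iff]
  rcases Fin.eq_self_or_eq_succAbove v w with rfl | ⟨u, rfl⟩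
  · exact absurd ((hadj w).mpr rfl) G.irrefl
  refine ⟨u, ?_⟩
  ext a b
  obtain ha | ⟨a, rfl⟩ := Fin.eq_self_or_eq_succAbove v a <;>
    obtain hb | ⟨b, rfl⟩ := Fin.eq_self_or_eq_succAbove v b
  · simp [ha, hb]
  · simp [ha, insertLeaf_adj_self, hadj]
  · rw [adj_comm, G.adj_comm]
    simp [hb, insertLeaf_adj_self, hadj]
  · simp [insertLeaf_adj_succAbove]

lemma Connected.card_neighborSet_pos {V : Type*} [Finite V] [Nontrivial V] {G : SimpleGraph V}
    (hG : G.Connected) (v : V) : 0 < Nat.card (G.neighborSet v) := by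
  obtain ⟨u, hu⟩ := hG.preconnected.exists_adj_of_nontrivial v
  have : Nonempty (G.neighborSet v) := ⟨u, hu⟩
  exact Nat.card_pos

lemma IsTree.exists_card_neighborSet_eq_one {V : Type*} [Finite V] [Nontrivial V]
    {G : SimpleGraph V} (hG : G.IsTree) : ∃ v, Nat.card (G.neighborSet v) = 1 := by
  classical
  have := Fintype.ofFinite V
  obtain ⟨v, hv⟩ := hG.exists_vert_degree_one_of_nontrivial
  exact ⟨v, by rwa [Nat.card_eq_fintype_card, card_neighborSet_eq_degree]⟩

lemma isTree_fin_two_iff {G : SimpleGraph (Fin 2)} : G.IsTree ↔ G = ⊤ := by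
  constructor
  · intro hG
    obtain ⟨u, hu⟩ := hG.connected.preconnected.exists_adj_of_nontrivial 0
    obtain rfl : u = 1 := by
      have := hu.ne
      omega
    ext a b
    fin_cases a <;> fin_cases b <;> simp [hu, hu.symm]
  · rintro rfl
    exact ⟨connected_top, .of_card_le_two (by simp)⟩

open Classical in
/-- The degree enumerator of the trees on `Fin n`. -/
noncomputable def treeEnumerator {n : ℕ} {R : Type*} [CommRing R] (x : Fin n → R) : R :=
  ∑ G : SimpleGraph (Fin n) with G.IsTree, ∏ i, x i ^ (Nat.card (G.neighborSet i) - 1)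

section TreeEnumerator

variable {R : Type*} [CommRing R]

lemma treeEnumerator_fin_two (x : Fin 2 → R) : treeEnumerator x = 1 := by
  classical
  have h : ∀ i : Fin 2, Nat.card ((⊤ : SimpleGraph (Fin 2)).neighborSet i) - 1 = 0 := by
    intro i
    rw [Nat.card_eq_fintype_card, card_neighborSet_eq_degree]
    simp
  have hfilter : Finset.univ.filter (IsTree (V := Fin 2)) = {⊤} := by
    ext G
    simp [isTree_fin_two_iff]
  rw [treeEnumerator, hfilter, Finset.sum_singleton]
  exact Finset.prod_eq_one fun i _ ↦ by rw [h, pow_zero]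

lemma prod_pow_card_neighborSet_insertLeaf {m : ℕ} [Nontrivial (Fin m)] {G : SimpleGraph (Fin m)}
    (hG : G.Connected) (v : Fin (m + 1)) (u : Fin m) (x : Fin (m + 1) → R) :
    ∏ i, x i ^ (Nat.card ((insertLeaf v G u).neighborSet i) - 1) =
      (∏ i, x (v.succAbove i) ^ (Nat.card (G.neighborSet i) - 1)) * x (v.succAbove u) := by
  have hexp (a : Fin m) :
      Nat.card (G.neighborSet a) + (if a = u then 1 else 0) - 1 =
        Nat.card (G.neighborSet a) - 1 + if a = u then 1 else 0 := by
    have := hG.card_neighborSet_pos a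
    omega
  simp only [Fin.prod_univ_succAbove _ v, card_neighborSet_insertLeaf_self,
    card_neighborSet_insertLeaf_succAbove, hexp, pow_add, Finset.prod_mul_distrib]
  simp

/-- If `x v = 0`, only the trees in which `v` is a leaf contribute to the enumerator. -/
lemma treeEnumerator_of_apply_eq_zero {m : ℕ} [Nontrivial (Fin m)] (v : Fin (m + 1))
    (x : Fin (m + 1) → R) (hx : x v = 0) :
    treeEnumerator x =
      treeEnumerator (fun i ↦ x (v.succAbove i)) * ∑ i, x (v.succAbove i) := by
  classical
  have hleaf : treeEnumerator x =
      ∑ G : SimpleGraph (Fin (m + 1)) with G.IsTree ∧ Nat.card (G.neighborSet v) = 1,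
        ∏ i, x i ^ (Nat.card (G.neighborSet i) - 1) := by
    symm
    rw [treeEnumerator]
    have : Nontrivial (Fin (m + 1)) := v.succAboveEmb.injective.nontrivial
    refine Finset.sum_subset_zero_on_sdiff (fun G ↦ by simp +contextual) (fun G hG ↦ ?_)
      (fun _ _ ↦ rfl)
    simp only [Finset.mem_sdiff, Finset.mem_filter, Finset.mem_univ, true_and, not_and] at hG
    refine Finset.prod_eq_zero (Finset.mem_univ v) ?_
    have hpos := hG.1.connected.card_neighborSet_pos v
    have hne := hG.2 hG.1
    rw [hx, zero_pow (by omega)]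
  rw [hleaf, treeEnumerator, Finset.sum_mul_sum, ← Finset.sum_product']
  symm
  refine Finset.sum_bij (fun p _ ↦ insertLeaf v p.1 p.2) ?_ ?_ ?_ ?_
  · rintro ⟨G, u⟩ hG
    simp only [Finset.mem_product, Finset.mem_filter, Finset.mem_univ, true_and, and_true] at hG ⊢
    exact ⟨hG.insertLeaf v u, card_neighborSet_insertLeaf_self⟩
  · rintro ⟨G, u⟩ - ⟨G', u'⟩ - h
    simp only at h
    have hu : u = u' := by
      rw [← insertLeaf_adj_self (v := v) (G := G'), ← h, insertLeaf_adj_self]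
    rw [← comap_insertLeaf (v := v) (G := G) (u := u), h, comap_insertLeaf, hu]
  · intro G hG
    simp only [Finset.mem_filter, Finset.mem_univ, true_and] at hG
    obtain ⟨u, hu⟩ := exists_insertLeaf_eq hG.2
    refine ⟨(G.comap v.succAboveEmb, u), Finset.mem_product.mpr ⟨?_, Finset.mem_univ u⟩, hu⟩
    exact Finset.mem_filter.mpr ⟨Finset.mem_univ _, hG.1.comap_succAboveEmb hG.2⟩
  · rintro ⟨G, u⟩ hG
    simp only [Finset.mem_product, Finset.mem_filter, Finset.mem_univ, true_and, and_true] at hG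
    exact (prod_pow_card_neighborSet_insertLeaf hG.connected v u x).symm

end TreeEnumerator

end SimpleGraph

section MissingVariable

variable {ι R : Type*} [Fintype ι] [DecidableEq ι] [CommRing R]

lemma sum_powerset_neg_one_pow_mul_prod_pow_eq_zero (y : ι → R) (a : ι → ℕ) {i : ι}
    (hi : a i = 0) :
    ∑ s ∈ (Finset.univ : Finset ι).powerset,
      (-1) ^ s.card * ∏ j, (if j ∈ s then 0 else y j) ^ a j = 0 := by
  have h := Finset.prod_sub (fun j ↦ y j ^ a j) (fun j ↦ (0 : R) ^ a j) Finset.univ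
  rw [Finset.prod_eq_zero (Finset.mem_univ i) (by simp [hi])] at h
  refine Eq.trans (Finset.sum_congr rfl fun s hs ↦ ?_) h.symm
  rw [mul_assoc, ← Finset.prod_sdiff (Finset.mem_powerset.mp hs)]
  congr 2
  · exact Finset.prod_congr rfl fun j hj ↦ by rw [if_neg (Finset.mem_sdiff.mp hj).2]
  · exact Finset.prod_congr rfl fun j hj ↦ by rw [if_pos hj]

/-- A sum of monomials, each of which misses some variable, is determined by its values where
some variable vanishes, by inclusion-exclusion. -/
lemma sum_monomials_eq_neg_sum_powerset_erase {α : Type*} (r : Finset α) (a : α → ι → ℕ)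
    (ha : ∀ k ∈ r, ∃ i, a k i = 0) (y : ι → R) :
    ∑ k ∈ r, ∏ i, y i ^ a k i =
      -∑ s ∈ (Finset.univ : Finset ι).powerset.erase ∅,
        (-1) ^ s.card * ∑ k ∈ r, ∏ j, (if j ∈ s then 0 else y j) ^ a k j := by
  have hzero : ∑ s ∈ (Finset.univ : Finset ι).powerset,
      (-1) ^ s.card * ∑ k ∈ r, ∏ j, (if j ∈ s then 0 else y j) ^ a k j = 0 := by
    simp_rw [Finset.mul_sum]
    rw [Finset.sum_comm]
    refine Finset.sum_eq_zero fun k hk ↦ ?_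
    obtain ⟨i, hi⟩ := ha k hk
    exact sum_powerset_neg_one_pow_mul_prod_pow_eq_zero y (a k) hi
  rw [← Finset.add_sum_erase _ _ (Finset.empty_mem_powerset _)] at hzero
  exact eq_neg_of_add_eq_zero_left (by simpa using hzero)

/-- Two sums of monomials, each of which misses some variable, agree as soon as they agree
wherever some variable vanishes. -/
lemma sum_monomials_eq_of_forall_apply_eq_zero {α β : Type*} (s : Finset α) (t : Finset β)
    (a : α → ι → ℕ) (b : β → ι → ℕ) (ha : ∀ k ∈ s, ∃ i, a k i = 0) (hb : ∀ k ∈ t, ∃ i, b k i = 0)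
    (h : ∀ y : ι → R, (∃ i, y i = 0) →
      ∑ k ∈ s, ∏ i, y i ^ a k i = ∑ k ∈ t, ∏ i, y i ^ b k i) (y : ι → R) :
    ∑ k ∈ s, ∏ i, y i ^ a k i = ∑ k ∈ t, ∏ i, y i ^ b k i := by
  rw [sum_monomials_eq_neg_sum_powerset_erase s a ha,
    sum_monomials_eq_neg_sum_powerset_erase t b hb]
  congr 1
  refine Finset.sum_congr rfl fun u hu ↦ ?_
  obtain ⟨i, hi⟩ := Finset.nonempty_iff_ne_empty.mpr (Finset.ne_of_mem_erase hu)
  rw [h _ ⟨i, if_pos hi⟩]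

lemma sum_pow_eq_sum_prod_pow_card_fiber (y : ι → R) (k : ℕ) :
    (∑ i, y i) ^ k =
      ∑ p : Fin k → ι, ∏ i, y i ^ (Finset.univ.filter fun j ↦ p j = i).card := by
  rw [Fintype.sum_pow]
  refine Finset.sum_congr rfl fun p _ ↦ ?_
  rw [← Finset.prod_fiberwise' Finset.univ p y]
  simp

end MissingVariable

lemma SimpleGraph.treeEnumerator_eq_sum_pow {R : Type*} [CommRing R] (m : ℕ)
    (x : Fin (m + 2) → R) : treeEnumerator x = (∑ i, x i) ^ m := by
  classical
  induction m with
  | zero => rw [treeEnumerator_fin_two, pow_zero]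
  | succ m ih =>
    rw [sum_pow_eq_sum_prod_pow_card_fiber]
    refine sum_monomials_eq_of_forall_apply_eq_zero _ _
      (fun (G : SimpleGraph (Fin (m + 1 + 2))) i ↦ Nat.card (G.neighborSet i) - 1)
      (fun (p : Fin (m + 1) → Fin (m + 1 + 2)) i ↦
        (Finset.univ.filter fun j ↦ p j = i).card) ?_ ?_ ?_ x
    · intro G hG
      obtain ⟨v, hv⟩ := (Finset.mem_filter.mp hG).2.exists_card_neighborSet_eq_one
      exact ⟨v, Nat.sub_eq_zero_of_le hv.le⟩
    · intro p _
      have hp : ¬ Function.Surjective p := fun hp ↦ by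
        simpa using Fintype.card_le_of_surjective p hp
      obtain ⟨i, hi⟩ := not_forall.mp hp
      exact ⟨i, by simpa [Finset.filter_eq_empty_iff] using hi⟩
    · rintro y ⟨v, hv⟩
      rw [← sum_pow_eq_sum_prod_pow_card_fiber]
      refine (treeEnumerator_of_apply_eq_zero v y hv).trans ?_
      rw [ih, Fin.sum_univ_succAbove y v, hv, zero_add, pow_succ]

/-- Weighted Cayley formula: the sum over all trees `T` on `{1, ..., n}` of
`∏ i, x i ^ (deg_T i - 1)` equals `(x₁ + ⋯ + xₙ) ^ (n - 2)`. -/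
theorem sum_trees_degree_weight (n : ℕ) (hn : 2 ≤ n) (R : Type*) [CommRing R]
    (x : Fin n → R) :
    ∑ᶠ T : {G : SimpleGraph (Fin n) // G.Connected ∧ G.IsAcyclic},
        ∏ i : Fin n, x i ^ (Nat.card (T.1.neighborSet i) - 1)
      = (∑ i : Fin n, x i) ^ (n - 2) := by
  classical
  obtain ⟨m, rfl⟩ := Nat.exists_eq_add_of_le' hn
  rw [Nat.add_sub_cancel, ← SimpleGraph.treeEnumerator_eq_sum_pow, SimpleGraph.treeEnumerator]
  refine (finsum_subtype_eq_finsum_cond (f := fun G : SimpleGraph (Fin (m + 2)) ↦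
    ∏ i, x i ^ (Nat.card (G.neighborSet i) - 1)) _).trans ?_
  refine finsum_cond_eq_sum_of_cond_iff _ fun _ ↦ ?_
  rw [Finset.mem_filter_univ, SimpleGraph.isTree_iff]
end

section
/- Let n ≥ 2 and let R be a commutative ring with elements p_i, q_i, s_i, t_i ∈ R for i = 1, ..., n. For a function f : {2, ..., n-1} → {1, ..., n} define W(f) = ∏_{i=2}^{n-1} w(i, f(i)), where w(i,j) = p_i·s_j if i < j and w(i,j) = q_i·t_j if i ≥ j. For a tree T on {1, ..., n}, define W(T) as the product over the edges {a, b} of T, oriented as (a, b) with b the endpoint strictly closer to vertex 1, of the weight p_a·s_b if a < b and q_a·t_b if a > b. Then there exists a bijection Θ from the set of functions f : {2, ..., n-1} → {1, ..., n} to the set of trees on {1, ..., n} such that for every such f, q_n·t_1·W(f) = W(Θ(f)). -/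
section

open Finset

theorem iterate_eq_of_agree {α : Type*} {F G : α → α} {x : α} {m : ℕ}
    (h : ∀ i < m, G (F^[i] x) = F (F^[i] x)) : ∀ i ≤ m, G^[i] x = F^[i] x := by
  intro i
  induction i with
  | zero => simp
  | succ i ih =>
    intro hi
    rw [Function.iterate_succ_apply', Function.iterate_succ_apply', ih (by omega), h i (by omega)]

theorem iterate_eq_of_agree_on_orbit {α : Type*} {F G : α → α} {x : α}
    (h : ∀ i, G (F^[i] x) = F (F^[i] x)) (i : ℕ) : G^[i] x = F^[i] x :=
  iterate_eq_of_agree (m := i) (fun i _ => h i) i le_rfl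

/-- The root `0` is fixed, the forward orbit of the last vertex stays below `k`, and every orbit
that stays below `k` reaches the root. -/
def CycleFreeBelow {m : ℕ} (k : ℕ) (F : Fin (m + 2) → Fin (m + 2)) : Prop :=
  F 0 = 0 ∧ (∀ j, (F^[j] (F (Fin.last _)) : ℕ) < k) ∧
    ∀ x, (∀ j, (F^[j] x : ℕ) < k) → ∃ j, F^[j] x = 0

/-- `k` is the maximum of its orbit, and this orbit avoids the root. -/
def IsOrbitMax {m : ℕ} (k : Fin (m + 2)) (F : Fin (m + 2) → Fin (m + 2)) : Prop :=
  (∀ j, F^[j] k ≤ k) ∧ ∀ j, F^[j] k ≠ 0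

/-- `k` lies on the forward orbit of the last vertex. -/
def OnLastOrbit {m : ℕ} (k : Fin (m + 2)) (F : Fin (m + 2) → Fin (m + 2)) : Prop :=
  ∃ j, F^[j] (F (Fin.last _)) = k

section Step

variable {m : ℕ} {k : Fin (m + 2)} {F : Fin (m + 2) → Fin (m + 2)}

theorem swap_comp_last : (F ∘ Equiv.swap (Fin.last _) k) (Fin.last _) = F k := by simp

theorem swap_comp_self : (F ∘ Equiv.swap (Fin.last _) k) k = F (Fin.last _) := by simp

theorem swap_comp_of_lt (hk : k < Fin.last _) {x : Fin (m + 2)} (hx : x < k) :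
    (F ∘ Equiv.swap (Fin.last _) k) x = F x := by
  simp [Equiv.swap_apply_of_ne_of_ne (hx.trans hk).ne hx.ne]

theorem iterate_fixed (h0 : F 0 = 0) {x : Fin (m + 2)} {i : ℕ} (hi : F^[i] x = 0) (j : ℕ)
    (hij : i ≤ j) : F^[j] x = 0 := by
  obtain ⟨d, rfl⟩ := Nat.exists_eq_add_of_le' hij
  rw [Function.iterate_add_apply, hi, Function.iterate_fixed h0]

theorem CycleFreeBelow.swap_of_isOrbitMax (hk0 : 0 < k) (hk : k < Fin.last _)
    (hF : CycleFreeBelow k F) (hP : IsOrbitMax k F) :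
    CycleFreeBelow (k + 1) (F ∘ Equiv.swap (Fin.last _) k) ∧
      OnLastOrbit k (F ∘ Equiv.swap (Fin.last _) k) := by
  classical
  obtain ⟨h0, hb, hc⟩ := hF
  obtain ⟨hle, hne⟩ := hP
  set G := F ∘ Equiv.swap (Fin.last _) k with hG
  have hrec : ∃ j, F^[j] (F k) = k := by
    by_contra! hcon
    obtain ⟨j, hj⟩ := hc (F k) fun j => lt_of_le_of_ne (hle (j + 1)) (Fin.val_ne_of_ne (hcon j))
    exact hne (j + 1) hj
  have hmin := fun i => Nat.find_min hrec (m := i)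
  have hjk := Nat.find_spec hrec
  set j := Nat.find hrec
  have h1 : ∀ i ≤ j, G^[i] (F k) = F^[i] (F k) := iterate_eq_of_agree fun i hi =>
    swap_comp_of_lt hk (lt_of_le_of_ne (hle (i + 1)) (hmin i hi))
  have h2 : ∀ i, G^[i] (F (Fin.last _)) = F^[i] (F (Fin.last _)) :=
    iterate_eq_of_agree_on_orbit fun i => swap_comp_of_lt hk (hb i)
  have hGk : G k = F (Fin.last _) := swap_comp_self
  have hGl : G (Fin.last _) = F k := swap_comp_last
  have hjG : G^[j] (G (Fin.last _)) = k := by rw [hGl, h1 j le_rfl, hjk]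
  have hk' : ∀ i, G^[i + 1] k = F^[i] (F (Fin.last _)) := fun i => by
    rw [Function.iterate_succ_apply, hGk, h2]
  refine ⟨⟨?_, fun i => ?_, fun x hx => ?_⟩, j, hjG⟩
  · rw [hG, swap_comp_of_lt hk hk0, h0]
  · rcases le_or_gt i j with hi | hi
    · rw [hGl, h1 i hi]
      exact Nat.lt_succ_of_le (hle (i + 1))
    · obtain ⟨d, rfl⟩ := Nat.exists_eq_add_of_lt hi
      rw [show j + d + 1 = (d + 1) + j by omega, Function.iterate_add_apply, hjG, hk']
      exact (hb d).trans (Nat.lt_succ_self _)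
  · by_cases hxk : ∃ i, G^[i] x = k
    · obtain ⟨i, hi⟩ := hxk
      obtain ⟨d, hd⟩ := hc _ hb
      exact ⟨d + 1 + i, by rw [Function.iterate_add_apply, hi, hk', hd]⟩
    · push Not at hxk
      have hlt : ∀ i, G^[i] x < k := fun i => lt_of_le_of_ne (Nat.le_of_lt_succ (hx i)) (hxk i)
      have h3 : ∀ i, F^[i] x = G^[i] x :=
        iterate_eq_of_agree_on_orbit fun i => (swap_comp_of_lt hk (hlt i)).symm
      simp only [← h3] at hlt ⊢
      exact hc x hlt

theorem CycleFreeBelow.succ_of_not_isOrbitMax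
    (hF : CycleFreeBelow k F) (hP : ¬ IsOrbitMax k F) :
    CycleFreeBelow (k + 1) F ∧ ¬ OnLastOrbit k F := by
  obtain ⟨h0, hb, hc⟩ := hF
  refine ⟨⟨h0, fun i => (hb i).trans (Nat.lt_succ_self _), fun x hx => ?_⟩, ?_⟩
  · by_cases hxk : ∃ i, F^[i] x = k
    · obtain ⟨i, hi⟩ := hxk
      have : ∃ d, F^[d] k = 0 := by
        by_contra! hcon
        refine hP ⟨fun d => ?_, hcon⟩
        rw [← hi, ← Function.iterate_add_apply, hi]
        exact Nat.le_of_lt_succ (hx _)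
      obtain ⟨d, hd⟩ := this
      exact ⟨d + i, by rw [Function.iterate_add_apply, hi, hd]⟩
    · push Not at hxk
      exact hc x fun i => lt_of_le_of_ne (Nat.le_of_lt_succ (hx i)) (Fin.val_ne_of_ne (hxk i))
  · rintro ⟨j, hj⟩
    have := hb j
    simp [hj] at this

theorem CycleFreeBelow.swap_of_onLastOrbit (hk0 : 0 < k) (hk : k < Fin.last _)
    (hF : CycleFreeBelow (k + 1) F) (hQ : OnLastOrbit k F) :
    CycleFreeBelow k (F ∘ Equiv.swap (Fin.last _) k) ∧
      IsOrbitMax k (F ∘ Equiv.swap (Fin.last _) k) := by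
  classical
  obtain ⟨h0, hb, hc⟩ := hF
  set G := F ∘ Equiv.swap (Fin.last _) k with hG
  have hmin := fun i => Nat.find_min hQ (m := i)
  have hjk := Nat.find_spec hQ
  set j := Nat.find hQ
  have hGk : G k = F (Fin.last _) := swap_comp_self
  have hGl : G (Fin.last _) = F k := swap_comp_last
  have hG0 : G 0 = 0 := by rw [hG, swap_comp_of_lt hk hk0, h0]
  have h1 : ∀ i ≤ j, G^[i] (F (Fin.last _)) = F^[i] (F (Fin.last _)) :=
    iterate_eq_of_agree fun i hi =>
      swap_comp_of_lt hk (lt_of_le_of_ne (Nat.le_of_lt_succ (hb i)) (hmin i hi))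
  have hper : G^[j + 1] k = k := by
    rw [Function.iterate_succ_apply, hGk, h1 j le_rfl, hjk]
  have hkorb : ∀ i, F^[i] (F k) ≤ k := fun i => by
    rw [← hjk, ← Function.iterate_succ_apply, ← Function.iterate_add_apply, hjk]
    exact Nat.le_of_lt_succ (hb _)
  have hknr : ∀ i, F^[i] (F k) ≠ k := fun i hi => by
    obtain ⟨d, hd⟩ := hc _ hb
    have hp : Function.IsPeriodicPt F (i + 1) k := hi
    have hkd : F^[d] k = 0 := by
      have := iterate_fixed h0 hd (d + j) (by omega)
      rwa [Function.iterate_add_apply, hjk] at this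
    have h3 := iterate_fixed h0 hkd ((i + 1) * (d + 1)) (by nlinarith)
    have h4 : F^[(i + 1) * (d + 1)] k = k := hp.mul_const (d + 1)
    exact hk0.ne (h3.symm.trans h4)
  have h2 : ∀ i, G^[i] (F k) = F^[i] (F k) :=
    iterate_eq_of_agree_on_orbit fun i => swap_comp_of_lt hk (lt_of_le_of_ne (hkorb i) (hknr i))
  have hper' : Function.IsPeriodicPt G (j + 1) k := hper
  refine ⟨⟨hG0, fun i => ?_, fun x hx => ?_⟩, fun i => ?_, fun i hi => ?_⟩
  · rw [hGl, h2]
    exact Fin.lt_def.1 (lt_of_le_of_ne (hkorb i) (hknr i))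
  · have h3 : ∀ i, F^[i] x = G^[i] x :=
      iterate_eq_of_agree_on_orbit fun i => (swap_comp_of_lt hk (hx i)).symm
    simp only [← h3] at hx ⊢
    exact hc x fun i => (hx i).trans (Nat.lt_succ_self _)
  · rw [← hper'.iterate_mod_apply]
    have hlt : i % (j + 1) < j + 1 := Nat.mod_lt i (Nat.succ_pos j)
    generalize i % (j + 1) = d at hlt ⊢
    rcases d with _ | d
    · simp
    · rw [Function.iterate_succ_apply, hGk, h1 d (by omega)]
      exact Nat.le_of_lt_succ (hb _)
  · have h3 := iterate_fixed hG0 hi ((j + 1) * i) (by nlinarith)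
    exact hk0.ne (h3.symm.trans (hper'.mul_const i))

theorem CycleFreeBelow.pred_of_not_onLastOrbit
    (hF : CycleFreeBelow (k + 1) F) (hQ : ¬ OnLastOrbit k F) :
    CycleFreeBelow k F ∧ ¬ IsOrbitMax k F := by
  obtain ⟨h0, hb, hc⟩ := hF
  refine ⟨⟨h0, fun i => lt_of_le_of_ne (Nat.le_of_lt_succ (hb i)) fun h => hQ ⟨i, Fin.ext h⟩,
    fun x hx => hc x fun i => (hx i).trans (Nat.lt_succ_self _)⟩, ?_⟩
  rintro ⟨h1, h2⟩
  obtain ⟨j, hj⟩ := hc k fun i => Nat.lt_succ_of_le (h1 i)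
  exact h2 j hj

end Step

section Weight

variable {m : ℕ} {R : Type*} [CommRing R]

/-- The weight of the arc from `i` to `j`. -/
def arcWeight (p q s t : ℕ → R) (i j : ℕ) : R :=
  if i < j then p (i + 1) * s (j + 1) else q (i + 1) * t (j + 1)

/-- The product of the weights of the arcs `i → F i` over the vertices other than the root. -/
def mapWeight (p q s t : ℕ → R) (F : Fin (m + 2) → Fin (m + 2)) : R :=
  ∏ i ∈ univ.erase (0 : Fin (m + 2)), arcWeight p q s t i (F i)

theorem mapWeight_swap (p q s t : ℕ → R) {F : Fin (m + 2) → Fin (m + 2)} {k : Fin (m + 2)}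
    (hk0 : 0 < k) (hk : k < Fin.last _) (hl : F (Fin.last _) ≤ k) (hFk : F k ≤ k) :
    mapWeight p q s t (F ∘ Equiv.swap (Fin.last _) k) = mapWeight p q s t F := by
  have hlm : Fin.last (m + 1) ∈ univ.erase (0 : Fin (m + 2)) := by simp
  have hkm : k ∈ (univ.erase (0 : Fin (m + 2))).erase (Fin.last _) := by
    simp [hk.ne, hk0.ne']
  unfold mapWeight
  rw [← mul_prod_erase _ _ hlm, ← mul_prod_erase _ _ hkm, ← mul_prod_erase _ _ hlm,
    ← mul_prod_erase _ _ hkm, swap_comp_last, swap_comp_self]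
  have hrest : ∀ i ∈ ((univ.erase (0 : Fin (m + 2))).erase (Fin.last _)).erase k,
      arcWeight p q s t i ((F ∘ Equiv.swap (Fin.last _) k) i) = arcWeight p q s t i (F i) := by
    intro i hi
    simp only [mem_erase] at hi
    simp [Equiv.swap_apply_of_ne_of_ne hi.2.1 hi.1]
  rw [prod_congr rfl hrest]
  have h1 : ∀ i j : Fin (m + 2), j ≤ i →
      arcWeight p q s t i j = q (i + 1) * t (j + 1) := fun i j h => if_neg (not_lt.2 h)
  rw [h1 _ _ (hl.trans hk.le), h1 _ _ (hFk.trans hk.le), h1 _ _ hl, h1 _ _ hFk]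
  ring

open Classical in
theorem exists_equiv_succ (p q s t : ℕ → R) {k : Fin (m + 2)} (hk0 : 0 < k)
    (hk : k < Fin.last _) :
    ∃ e : {F : Fin (m + 2) → Fin (m + 2) // CycleFreeBelow k F} ≃
        {F : Fin (m + 2) → Fin (m + 2) // CycleFreeBelow (k + 1) F},
      ∀ F, mapWeight p q s t (e F).1 = mapWeight p q s t F.1 := by
  have hinv : ∀ F : Fin (m + 2) → Fin (m + 2),
      (F ∘ Equiv.swap (Fin.last _) k) ∘ Equiv.swap (Fin.last _) k = F := fun F => by
    funext x; simp
  refine ⟨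
    { toFun := fun F => if h : IsOrbitMax k F.1
        then ⟨_, (F.2.swap_of_isOrbitMax hk0 hk h).1⟩ else ⟨_, (F.2.succ_of_not_isOrbitMax h).1⟩
      invFun := fun F => if h : OnLastOrbit k F.1
        then ⟨_, (F.2.swap_of_onLastOrbit hk0 hk h).1⟩ else ⟨_, (F.2.pred_of_not_onLastOrbit h).1⟩
      left_inv := fun F => ?_
      right_inv := fun F => ?_ }, fun F => ?_⟩
  · by_cases h : IsOrbitMax k F.1
    · simp [h, (F.2.swap_of_isOrbitMax hk0 hk h).2, hinv]
    · simp [h, (F.2.succ_of_not_isOrbitMax h).2]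
  · by_cases h : OnLastOrbit k F.1
    · simp [h, (F.2.swap_of_onLastOrbit hk0 hk h).2, hinv]
    · simp [h, (F.2.pred_of_not_onLastOrbit h).2]
  · by_cases h : IsOrbitMax k F.1
    · simpa [h] using mapWeight_swap p q s t hk0 hk (F.2.2.1 0).le (h.1 1)
    · simp [h]

theorem exists_equiv_of_le (p q s t : ℕ → R) (k : ℕ) (hk : k ≤ m) :
    ∃ e : {F : Fin (m + 2) → Fin (m + 2) // CycleFreeBelow 1 F} ≃
        {F : Fin (m + 2) → Fin (m + 2) // CycleFreeBelow (k + 1) F},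
      ∀ F, mapWeight p q s t (e F).1 = mapWeight p q s t F.1 := by
  induction k with
  | zero => exact ⟨Equiv.refl _, fun _ => rfl⟩
  | succ k ih =>
    obtain ⟨e, he⟩ := ih (by omega)
    obtain ⟨e', he'⟩ := exists_equiv_succ p q s t (k := (⟨k + 1, by omega⟩ : Fin (m + 2)))
      (Nat.succ_pos k) (Nat.succ_lt_succ hk)
    exact ⟨e.trans e', fun F => (he' _).trans (he F)⟩

end Weight

section ParentGraph

variable {V : Type*} {r : V} {F : V → V}

/-- The undirected graph with an edge between each vertex and its image, loops discarded. -/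
def parentGraph (F : V → V) : SimpleGraph V :=
  SimpleGraph.fromRel fun a b => F a = b

theorem parentGraph_reachable_iterate (F : V → V) (x : V) (j : ℕ) :
    (parentGraph F).Reachable x (F^[j] x) := by
  induction j with
  | zero => exact SimpleGraph.Reachable.refl _
  | succ j ih =>
    refine ih.trans ?_
    rw [Function.iterate_succ_apply']
    by_cases h : F^[j] x = F (F^[j] x)
    · rw [← h]
    · exact SimpleGraph.Adj.reachable ⟨h, Or.inl rfl⟩

theorem parentGraph_connected (hF : ∀ x, ∃ j, F^[j] x = r) : (parentGraph F).Connected := by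
  have hr : ∀ x, (parentGraph F).Reachable x r := fun x => by
    obtain ⟨j, hj⟩ := hF x
    exact hj ▸ parentGraph_reachable_iterate F x j
  have : Nonempty V := ⟨r⟩
  exact ⟨fun x y => (hr x).trans (hr y).symm⟩

theorem parentGraph_isTree [Fintype V] [DecidableEq V] (h0 : F r = r)
    (hF : ∀ x, ∃ j, F^[j] x = r) : (parentGraph F).IsTree := by
  have hconn := parentGraph_connected hF
  rw [SimpleGraph.isTree_iff_connected_and_card]
  refine ⟨hconn, le_antisymm ?_ hconn.card_vert_le_card_edgeSet_add_one⟩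
  have hsub : (parentGraph F).edgeSet ⊆
      ((univ.erase r).image fun a => s(a, F a) : Finset (Sym2 V)) := by
    intro e
    induction e with | _ a b
    rintro ⟨hne, h | h⟩
    · simp only [coe_image, Set.mem_image, SetLike.mem_coe, mem_erase, mem_univ, and_true]
      exact ⟨a, fun ha => hne (by rw [← h, ha, h0]), by rw [h]⟩
    · simp only [coe_image, Set.mem_image, SetLike.mem_coe, mem_erase, mem_univ, and_true]
      exact ⟨b, fun hb => hne (by rw [← h, hb, h0]), by rw [h, Sym2.eq_swap]⟩
  have h1 := Set.ncard_le_ncard hsub (Finset.finite_toSet _)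
  rw [Set.ncard_coe_finset] at h1
  have h2 := h1.trans card_image_le
  rw [card_erase_of_mem (mem_univ r), card_univ] at h2
  have h3 : 0 < Fintype.card V := Fintype.card_pos_iff.2 ⟨r⟩
  rw [Nat.card_coe_set_eq, Nat.card_eq_fintype_card]
  omega

theorem SimpleGraph.Connected.exists_adj_dist_lt {G : SimpleGraph V} (hG : G.Connected)
    {a : V} (ha : a ≠ r) : ∃ b, G.Adj a b ∧ G.dist b r < G.dist a r := by
  obtain ⟨w, hw⟩ := hG.exists_walk_length_eq_dist a r
  cases w with
  | nil => exact absurd rfl ha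
  | cons h w' =>
    refine ⟨_, h, ?_⟩
    have := SimpleGraph.dist_le w'
    rw [SimpleGraph.Walk.length_cons] at hw
    omega

theorem parentGraph_dist_lt (h0 : F r = r) (hF : ∀ x, ∃ j, F^[j] x = r) :
    ∀ (d : ℕ) (a : V), (parentGraph F).dist a r = d → a ≠ r → (parentGraph F).dist (F a) r < d := by
  intro d
  induction d using Nat.strong_induction_on with
  | _ d ih =>
    intro a had ha
    obtain ⟨b, ⟨-, hab⟩, hlt⟩ := (parentGraph_connected hF).exists_adj_dist_lt ha
    rw [had] at hlt
    rcases hab with h | h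
    · exact h ▸ hlt
    · have hb : b ≠ r := fun hb => ha (by rw [← h, hb, h0])
      have := ih _ hlt b rfl hb
      rw [h] at this
      omega

theorem parentGraph_adj_and_dist_lt_iff (h0 : F r = r) (hF : ∀ x, ∃ j, F^[j] x = r) {a b : V} :
    (parentGraph F).Adj a b ∧ (parentGraph F).dist b r < (parentGraph F).dist a r ↔
      a ≠ r ∧ b = F a := by
  constructor
  · rintro ⟨⟨-, h⟩, hlt⟩
    have ha : a ≠ r := by
      rintro rfl
      simp at hlt
    refine ⟨ha, ?_⟩
    rcases h with h | h
    · exact h.symm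
    · have hb : b ≠ r := fun hb => ha (by rw [← h, hb, h0])
      have := parentGraph_dist_lt h0 hF _ b rfl hb
      rw [h] at this
      omega
  · rintro ⟨ha, rfl⟩
    have := parentGraph_dist_lt h0 hF _ a rfl ha
    exact ⟨⟨fun h => by rw [← h] at this; omega, Or.inl rfl⟩, this⟩

theorem parentGraph_injective {F' : V → V} (h0 : F r = r) (hF : ∀ x, ∃ j, F^[j] x = r)
    (h0' : F' r = r) (hF' : ∀ x, ∃ j, F'^[j] x = r) (h : parentGraph F = parentGraph F') :
    F = F' := by
  funext a
  by_cases ha : a = r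
  · rw [ha, h0, h0']
  · have h1 := (parentGraph_adj_and_dist_lt_iff h0 hF).2 ⟨ha, rfl⟩
    rw [h] at h1
    exact ((parentGraph_adj_and_dist_lt_iff h0' hF').1 h1).2

theorem exists_parentGraph_eq {G : SimpleGraph V} (hG : G.IsTree) (r : V) :
    ∃ F : V → V, F r = r ∧ (∀ x, ∃ j, F^[j] x = r) ∧ parentGraph F = G := by
  classical
  choose! g hg using fun a (ha : a ≠ r) => hG.connected.exists_adj_dist_lt ha
  set F : V → V := fun a => if a = r then r else g a with hFdef
  have hFg : ∀ a, a ≠ r → F a = g a := fun a ha => if_neg ha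
  have hreach : ∀ (d : ℕ) (x : V), G.dist x r = d → ∃ j, F^[j] x = r := by
    intro d
    induction d using Nat.strong_induction_on with
    | _ d ih =>
      intro x hx
      by_cases hxr : x = r
      · exact ⟨0, hxr⟩
      · obtain ⟨j, hj⟩ := ih _ (hx ▸ (hg x hxr).2) (g x) rfl
        exact ⟨j + 1, by rw [Function.iterate_succ_apply, hFg x hxr, hj]⟩
  have hF : ∀ x, ∃ j, F^[j] x = r := fun x => hreach _ x rfl
  have h0 : F r = r := if_pos rfl
  have hle : parentGraph F ≤ G := by
    have key : ∀ a b, a ≠ b → F a = b → G.Adj a b := by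
      rintro a b hne rfl
      have ha : a ≠ r := fun ha => hne (by rw [ha, h0])
      rw [hFg a ha]
      exact (hg a ha).1
    rintro a b ⟨hne, h | h⟩
    · exact key a b hne h
    · exact (key b a hne.symm h).symm
  exact ⟨F, h0, hF, le_antisymm hle
    ((SimpleGraph.isTree_iff_minimal_connected.1 hG).2 (parentGraph_connected hF) hle)⟩

end ParentGraph

section Ends

variable {m : ℕ} {F : Fin (m + 2) → Fin (m + 2)}

theorem cycleFreeBelow_one_iff : CycleFreeBelow 1 F ↔ F 0 = 0 ∧ F (Fin.last _) = 0 := by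
  constructor
  · rintro ⟨h0, hb, -⟩
    exact ⟨h0, Fin.ext (Nat.lt_one_iff.1 (hb 0))⟩
  · rintro ⟨h0, hl⟩
    refine ⟨h0, fun j => ?_, fun x hx => ⟨0, Fin.ext (Nat.lt_one_iff.1 (hx 0))⟩⟩
    rw [hl, Function.iterate_fixed h0]
    simp

theorem cycleFreeBelow_last_iff :
    CycleFreeBelow (m + 1) F ↔ F 0 = 0 ∧ ∀ x, ∃ j, F^[j] x = 0 := by
  constructor
  · rintro ⟨h0, hb, hc⟩
    refine ⟨h0, fun x => ?_⟩
    by_cases hx : ∃ i, F^[i] x = Fin.last _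
    · obtain ⟨i, hi⟩ := hx
      obtain ⟨j, hj⟩ := hc _ hb
      refine ⟨j + 1 + i, ?_⟩
      rw [Function.iterate_add_apply, hi, Function.iterate_succ_apply, hj]
    · push Not at hx
      exact hc x fun i => Fin.val_lt_last (hx i)
  · rintro ⟨h0, hc⟩
    refine ⟨h0, fun i => Fin.val_lt_last fun hi => ?_, fun x _ => hc x⟩
    obtain ⟨d, hd⟩ := hc (Fin.last _)
    have hp : Function.IsPeriodicPt F (i + 1) (Fin.last _) := hi
    have h3 := iterate_fixed h0 hd ((i + 1) * d) (by nlinarith)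
    have h4 : F^[(i + 1) * d] (Fin.last _) = Fin.last _ := hp.mul_const d
    exact (Fin.last_pos (n := m)).ne (h3.symm.trans h4)

/-- Parent functions with root `0` correspond to trees. -/
theorem exists_equiv_trees (m : ℕ) :
    ∃ e : {F : Fin (m + 2) → Fin (m + 2) // CycleFreeBelow (m + 1) F} ≃
        {G : SimpleGraph (Fin (m + 2)) // G.Connected ∧ G.IsAcyclic},
      ∀ F, (e F).1 = parentGraph F.1 := by
  have hroot := fun F : {F : Fin (m + 2) → Fin (m + 2) // CycleFreeBelow (m + 1) F} =>
    cycleFreeBelow_last_iff.1 F.2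
  refine ⟨Equiv.ofBijective
    (fun F => ⟨parentGraph F.1, (parentGraph_isTree (hroot F).1 (hroot F).2).connected,
      (parentGraph_isTree (hroot F).1 (hroot F).2).isAcyclic⟩)
    ⟨fun F F' h => ?_, fun G => ?_⟩, fun F => rfl⟩
  · exact Subtype.ext (parentGraph_injective (hroot F).1 (hroot F).2 (hroot F').1 (hroot F').2
      (congrArg Subtype.val h))
  · obtain ⟨F, h0, hF, hFG⟩ := exists_parentGraph_eq ⟨G.2.1, G.2.2⟩ 0
    exact ⟨⟨F, cycleFreeBelow_last_iff.2 ⟨h0, hF⟩⟩, Subtype.ext hFG⟩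

variable {R : Type*} [CommRing R]

theorem finprod_parentGraph (p q s t : ℕ → R) (h0 : F 0 = 0) (hF : ∀ x, ∃ j, F^[j] x = 0) :
    (∏ᶠ (a : Fin (m + 2)) (b : Fin (m + 2)) (_ : (parentGraph F).Adj a b ∧
      (parentGraph F).dist b 0 < (parentGraph F).dist a 0), arcWeight p q s t a b) =
      mapWeight p q s t F := by
  simp only [parentGraph_adj_and_dist_lt_iff h0 hF]
  have h1 : ∀ a : Fin (m + 2), (∏ᶠ (b : Fin (m + 2)) (_ : a ≠ 0 ∧ b = F a),
      arcWeight p q s t a b) = if a ≠ 0 then arcWeight p q s t a (F a) else 1 := by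
    intro a
    by_cases ha : a = 0
    · simp [ha]
    · simp [ha]
  rw [finprod_congr h1, finprod_eq_prod_of_fintype, prod_ite, prod_const_one, mul_one,
    filter_ne', mapWeight]

/-- A function `{2, ..., m + 1} → {1, ..., m + 2}` of labels, as a self-map of the vertices sending
both extreme vertices to the root. -/
def extendByRoot (f : ↥(Icc 2 (m + 2 - 1)) → ↥(Icc 1 (m + 2))) (i : Fin (m + 2)) : Fin (m + 2) :=
  if h : (i : ℕ) + 1 ∈ Icc 2 (m + 2 - 1) then
    ⟨(f ⟨i + 1, h⟩ : ℕ) - 1, by have := mem_Icc.1 (f ⟨i + 1, h⟩).2; omega⟩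
  else 0

theorem extendByRoot_val_add_one (f : ↥(Icc 2 (m + 2 - 1)) → ↥(Icc 1 (m + 2)))
    (i : Fin (m + 2)) (h : (i : ℕ) + 1 ∈ Icc 2 (m + 2 - 1)) :
    (extendByRoot f i : ℕ) + 1 = f ⟨i + 1, h⟩ := by
  have := mem_Icc.1 (f ⟨i + 1, h⟩).2
  simp only [extendByRoot, h, dif_pos]
  omega

theorem extendByRoot_zero (f : ↥(Icc 2 (m + 2 - 1)) → ↥(Icc 1 (m + 2))) :
    extendByRoot f 0 = 0 := by
  simp [extendByRoot]

theorem extendByRoot_last (f : ↥(Icc 2 (m + 2 - 1)) → ↥(Icc 1 (m + 2))) :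
    extendByRoot f (Fin.last _) = 0 := by
  simp [extendByRoot]

theorem exists_equiv_extendByRoot (m : ℕ) :
    ∃ e : (↥(Icc 2 (m + 2 - 1)) → ↥(Icc 1 (m + 2))) ≃
        {F : Fin (m + 2) → Fin (m + 2) // CycleFreeBelow 1 F},
      ∀ f, (e f).1 = extendByRoot f := by
  refine ⟨Equiv.ofBijective
    (fun f => ⟨extendByRoot f,
      cycleFreeBelow_one_iff.2 ⟨extendByRoot_zero f, extendByRoot_last f⟩⟩)
    ⟨fun f f' h => ?_, fun F => ?_⟩, fun f => rfl⟩
  · funext ⟨i, hi⟩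
    have hi' := mem_Icc.1 hi
    obtain ⟨i, rfl⟩ := Nat.exists_eq_add_of_le' (show 1 ≤ i by omega)
    have h1 := extendByRoot_val_add_one f ⟨i, by omega⟩ hi
    have h2 := extendByRoot_val_add_one f' ⟨i, by omega⟩ hi
    rw [show extendByRoot f = extendByRoot f' from congrArg Subtype.val h] at h1
    exact Subtype.ext (h1.symm.trans h2)
  · have hF := cycleFreeBelow_one_iff.1 F.2
    refine ⟨fun i => ⟨F.1 ⟨i - 1, by have := mem_Icc.1 i.2; omega⟩ + 1, ?_⟩,
      Subtype.ext (funext fun i => ?_)⟩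
    · rw [mem_Icc]
      omega
    · by_cases h : (i : ℕ) + 1 ∈ Icc 2 (m + 2 - 1)
      · refine Fin.ext (Nat.succ_injective ?_)
        exact extendByRoot_val_add_one _ i h
      · simp only [extendByRoot, h, dif_neg, not_false_eq_true]
        rw [mem_Icc] at h
        have : i = 0 ∨ i = Fin.last _ := by
          simp only [Fin.ext_iff, Fin.val_zero, Fin.val_last]
          omega
        rcases this with rfl | rfl
        · exact hF.1.symm
        · exact hF.2.symm

theorem mapWeight_extendByRoot (p q s t : ℕ → R)
    (f : ↥(Icc 2 (m + 2 - 1)) → ↥(Icc 1 (m + 2))) :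
    mapWeight p q s t (extendByRoot f) =
      q (m + 2) * t 1 * ∏ i : ↥(Icc 2 (m + 2 - 1)),
        (if (i : ℕ) < f i then p i * s (f i) else q i * t (f i)) := by
  have hlm : Fin.last (m + 1) ∈ univ.erase (0 : Fin (m + 2)) := by simp
  rw [mapWeight, ← mul_prod_erase _ _ hlm, extendByRoot_last]
  refine congrArg₂ (· * ·) ?_ ?_
  · simp [arcWeight]
  · symm
    refine prod_bij (fun i _ => (⟨(i : ℕ) - 1, by have := mem_Icc.1 i.2; omega⟩ : Fin (m + 2)))
      (fun i _ => ?_) (fun i _ j _ h => ?_) (fun i hi => ?_) (fun i _ => ?_)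
    · have := mem_Icc.1 i.2
      simp only [mem_erase, ne_eq, Fin.ext_iff, Fin.val_last, Fin.val_zero, mem_univ, and_true]
      omega
    · have := mem_Icc.1 i.2
      have := mem_Icc.1 j.2
      simp only [Fin.mk.injEq] at h
      exact Subtype.ext (by omega)
    · simp only [mem_erase, ne_eq, Fin.ext_iff, Fin.val_last, Fin.val_zero, mem_univ,
        and_true] at hi
      exact ⟨⟨i + 1, mem_Icc.2 (by omega)⟩, mem_univ _, by simp⟩
    · obtain ⟨i, hi⟩ := i
      have hi' := mem_Icc.1 hi
      obtain ⟨i, rfl⟩ := Nat.exists_eq_add_of_le' (show 1 ≤ i by omega)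
      have h1 := extendByRoot_val_add_one f ⟨i, by omega⟩ hi
      simp only [arcWeight, Nat.add_sub_cancel, ← h1, add_lt_add_iff_right]

end Ends

end

/-- There is a bijection `Θ` from functions `f : {2, ..., n-1} → {1, ..., n}`
to trees on `{1, ..., n}` such that `qₙ·t₁·W(f) = W(Θ f)`, where
`W(f) = ∏_{i=2}^{n-1} w(i, f i)` with `w(i,j) = pᵢ·sⱼ` if `i < j` and
`w(i,j) = qᵢ·tⱼ` if `i ≥ j`, and `W(T)` is the product over the edges of `T`,
oriented as `(a, b)` with `b` the endpoint strictly closer to vertex `1`, of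
`p_a·s_b` if `a < b` and `q_a·t_b` if `a > b`.  Vertices of the trees are
modeled as `Fin n`, vertex `v` carrying the label `v + 1`. -/
theorem exists_weight_preserving_bijection (n : ℕ) (hn : 2 ≤ n) (R : Type*) [CommRing R]
    (p q s t : ℕ → R) :
    ∃ Θ : (↥(Finset.Icc 2 (n - 1)) → ↥(Finset.Icc 1 n)) →
        {G : SimpleGraph (Fin n) // G.Connected ∧ G.IsAcyclic},
      Function.Bijective Θ ∧
      ∀ f : ↥(Finset.Icc 2 (n - 1)) → ↥(Finset.Icc 1 n),
        q n * t 1 *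
          ∏ i : ↥(Finset.Icc 2 (n - 1)),
            (if (i : ℕ) < ((f i : ℕ)) then p (i : ℕ) * s ((f i : ℕ))
             else q (i : ℕ) * t ((f i : ℕ)))
        = ∏ᶠ (a : Fin n) (b : Fin n)
            (_ : (Θ f).1.Adj a b ∧
                 (Θ f).1.dist b (⟨0, by omega⟩ : Fin n) <
                   (Θ f).1.dist a (⟨0, by omega⟩ : Fin n)),
            (if (a : ℕ) < (b : ℕ) then p ((a : ℕ) + 1) * s ((b : ℕ) + 1)
             else q ((a : ℕ) + 1) * t ((b : ℕ) + 1)) := by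
  obtain ⟨m, rfl⟩ := Nat.exists_eq_add_of_le' hn
  obtain ⟨e₁, he₁⟩ := exists_equiv_extendByRoot m
  obtain ⟨e₂, he₂⟩ := exists_equiv_of_le p q s t m le_rfl
  obtain ⟨e₃, he₃⟩ := exists_equiv_trees m
  refine ⟨(e₁.trans e₂).trans e₃, Equiv.bijective _, fun f => ?_⟩
  obtain ⟨h0, hF⟩ := cycleFreeBelow_last_iff.1 (e₂ (e₁ f)).2
  rw [Equiv.trans_apply, Equiv.trans_apply, he₃, ← mapWeight_extendByRoot, ← he₁, ← he₂,
    ← finprod_parentGraph p q s t h0 hF]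
  rfl
end
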